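/- arXiv:2008.09467 — 4 statements merged into one kernel-verified Lean document; each statement's English description precedes it below -/
import Mathlib

section
/- Let G be a finite 3-connected simple graph that admits an embedding of genus 0 (i.e., G is planar). Then every genus-0 embedding of G is polyhedral, any two genus-0 embeddings of G are equal or mirror images of each other, and every polyhedral embedding of G has genus 0. In particular, a 3-connected planar graph has, up to mirror images, a unique polyhedral embedding, and it is a genus embedding. -/
open SimpleGraph

/-- A graph is cubic if every vertex has degree `3`. -/
def SimpleGraph.IsCubic {V : Type*} (G : SimpleGraph V) : Prop :=
  ∀ v : V, Nat.card (G.neighborSet v) = 3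

/-- A combinatorial (orientable) embedding of a graph `G`, given as a rotation system:
a permutation of the darts of `G` whose orbits are exactly the sets of darts
sharing a common tail. -/
structure RotationSystem {V : Type*} [Fintype V] [DecidableEq V] (G : SimpleGraph V) where
  σ : Equiv.Perm G.Dart
  tail_fixed : ∀ d : G.Dart, (σ d).fst = d.fst
  orbit_tail : ∀ d d' : G.Dart, d.fst = d'.fst → σ.SameCycle d d'

namespace RotationSystem

variable {V : Type*} [Fintype V] [DecidableEq V] {G : SimpleGraph V}

/-- The involutive permutation of darts reversing the orientation. -/
def dartSymmPerm (G : SimpleGraph V) : Equiv.Perm G.Dart :=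
  ⟨SimpleGraph.Dart.symm, SimpleGraph.Dart.symm,
    fun d => d.symm_symm, fun d => d.symm_symm⟩

/-- The permutation sending a dart `d` to `σ (d⁻¹)`; its orbits are the faces
of the embedding. -/
def faceMap (R : RotationSystem G) : Equiv.Perm G.Dart :=
  (dartSymmPerm G).trans R.σ

/-- Two darts lie on the same face iff they are in the same orbit of the face map. -/
def SameFace (R : RotationSystem G) : G.Dart → G.Dart → Prop :=
  (R.faceMap).SameCycle

/-- The set of vertices of the face (of the embedding `R`) containing the dart `d`. -/
def faceVerts (R : RotationSystem G) (d : G.Dart) : Set V :=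
  {v | ∃ d' : G.Dart, R.SameFace d d' ∧ d'.fst = v}

/-- The set of edges of the face (of the embedding `R`) containing the dart `d`. -/
def faceEdges (R : RotationSystem G) (d : G.Dart) : Set (Sym2 V) :=
  {e | ∃ d' : G.Dart, R.SameFace d d' ∧ d'.edge = e}

/-- Every facial walk of the embedding is a simple cycle, i.e. no facial walk
visits a vertex twice. -/
def FacesSimple (R : RotationSystem G) : Prop :=
  ∀ d d' : G.Dart, R.SameFace d d' → d.fst = d'.fst → d = d'

/-- An embedding is polyhedral if every facial walk is a simple cycle and the
intersection of any two distinct faces (as subgraphs) is empty, a single vertex,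
or a single edge. -/
def Polyhedral (R : RotationSystem G) : Prop :=
  R.FacesSimple ∧
  ∀ d d' : G.Dart, ¬ R.SameFace d d' →
    (R.faceVerts d ∩ R.faceVerts d' = ∅) ∨
    (∃ v : V, R.faceVerts d ∩ R.faceVerts d' = {v} ∧
      R.faceEdges d ∩ R.faceEdges d' = ∅) ∨
    (∃ u w : V, G.Adj u w ∧ R.faceVerts d ∩ R.faceVerts d' = {u, w} ∧
      R.faceEdges d ∩ R.faceEdges d' = {s(u, w)})

/-- The number of faces of the embedding. -/
noncomputable def numFaces (R : RotationSystem G) : ℕ :=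
  Nat.card (Quot R.SameFace)

/-- The embedding has genus `g`, defined via Euler's formula
`|V| - |E| + F = 2 - 2g`. -/
def HasGenus (R : RotationSystem G) (g : ℕ) : Prop :=
  (Fintype.card V : ℤ) - Nat.card G.edgeSet + R.numFaces = 2 - 2 * (g : ℤ)

end RotationSystem

/-- A graph is 3-connected if it has at least 4 vertices and removing any set of at
most 2 vertices leaves a connected graph. -/
def SimpleGraph.ThreeConnected {V : Type*} [Fintype V] (G : SimpleGraph V) : Prop :=
  4 ≤ Fintype.card V ∧
    ∀ S : Set V, S.ncard ≤ 2 → (G.induce (Sᶜ : Set V)).Connected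


set_option linter.unusedSectionVars false

section Exactness

open Matrix

/-- Submodules of constant functions have dimension at most one. -/
lemma finrank_const_le_one {X : Type*} [Fintype X]
    (W : Submodule (ZMod 2) (X → ZMod 2)) (h : ∀ x ∈ W, ∀ i j, x i = x j) :
    Module.finrank (ZMod 2) W ≤ 1 := by
  have hle : W ≤ Submodule.span (ZMod 2) {(fun _ => 1 : X → ZMod 2)} := by
    intro x hx
    rw [Submodule.mem_span_singleton]
    by_cases hX : Nonempty X
    · obtain ⟨i⟩ := hX
      refine ⟨x i, ?_⟩
      funext j
      simp [h x hx i j]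
    · refine ⟨0, ?_⟩
      funext j
      exact absurd ⟨j⟩ hX
  exact (Submodule.finrank_mono hle).trans (by
    simpa using finrank_span_le_card (R := ZMod 2) ({(fun _ => 1 : X → ZMod 2)} : Set (X → ZMod 2)))

/-- Exactness of a length two complex over `𝔽₂` from an Euler characteristic count. -/
lemma exact_of_card {X Y Z : Type*} [Fintype X] [Fintype Y] [Fintype Z]
    [DecidableEq X] [DecidableEq Y] [DecidableEq Z]
    (M : Matrix Z Y (ZMod 2)) (N : Matrix Y X (ZMod 2)) (hMN : ∀ x, M *ᵥ (N *ᵥ x) = 0)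
    (hN : ∀ x, N *ᵥ x = 0 → ∀ i j, x i = x j)
    (hM : ∀ z, Mᵀ *ᵥ z = 0 → ∀ i j, z i = z j)
    (hc : Fintype.card X + Fintype.card Z = Fintype.card Y + 2)
    (y : Y → ZMod 2) (hy : M *ᵥ y = 0) : ∃ x, N *ᵥ x = y := by
  have h1 := LinearMap.finrank_range_add_finrank_ker N.mulVecLin
  have h2 := LinearMap.finrank_range_add_finrank_ker M.mulVecLin
  have h3 := LinearMap.finrank_range_add_finrank_ker Mᵀ.mulVecLin
  have h4 : Module.finrank (ZMod 2) (LinearMap.ker N.mulVecLin) ≤ 1 :=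
    finrank_const_le_one _ (fun x hx => hN x (by simpa using hx))
  have h5 : Module.finrank (ZMod 2) (LinearMap.ker Mᵀ.mulVecLin) ≤ 1 :=
    finrank_const_le_one _ (fun x hx => hM x (by simpa only [LinearMap.mem_ker, Matrix.mulVecLin_apply] using hx))
  have h6 : Module.finrank (ZMod 2) (LinearMap.range Mᵀ.mulVecLin) =
      Module.finrank (ZMod 2) (LinearMap.range M.mulVecLin) := Matrix.rank_transpose M
  simp only [Module.finrank_fintype_fun_eq_card] at h1 h2 h3
  have hle : LinearMap.range N.mulVecLin ≤ LinearMap.ker M.mulVecLin := by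
    rintro _ ⟨x, rfl⟩
    simpa using hMN x
  have heq := Submodule.eq_of_le_of_finrank_le hle (by omega)
  have : y ∈ LinearMap.range N.mulVecLin := by
    rw [heq]; simpa using hy
  obtain ⟨x, hx⟩ := this
  exact ⟨x, by simpa using hx⟩

lemma zmod2_add_eq_zero {a b : ZMod 2} : a + b = 0 ↔ a = b := by
  revert a b; decide

end Exactness

namespace RotationSystem

variable {V : Type*} [Fintype V] [DecidableEq V] {G : SimpleGraph V}

lemma faceMap_apply (R : RotationSystem G) (d : G.Dart) : R.faceMap d = R.σ d.symm := rfl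

lemma faceMap_symm (R : RotationSystem G) (d : G.Dart) : R.faceMap d.symm = R.σ d := by
  rw [faceMap_apply, SimpleGraph.Dart.symm_symm]

lemma faceMap_fst (R : RotationSystem G) (d : G.Dart) : (R.faceMap d).fst = d.snd := by
  rw [faceMap_apply, R.tail_fixed]; rfl

lemma sameFace_refl (R : RotationSystem G) (d : G.Dart) : R.SameFace d d :=
  Equiv.Perm.SameCycle.refl _ _

lemma SameFace.symm {R : RotationSystem G} {d e : G.Dart} (h : R.SameFace d e) :
    R.SameFace e d := Equiv.Perm.SameCycle.symm h

lemma SameFace.trans {R : RotationSystem G} {d e f : G.Dart} (h : R.SameFace d e)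
    (h' : R.SameFace e f) : R.SameFace d f := Equiv.Perm.SameCycle.trans h h'

lemma sameFace_faceMap (R : RotationSystem G) (d : G.Dart) : R.SameFace d (R.faceMap d) :=
  ⟨1, by simp⟩

lemma sameFace_symm_σ (R : RotationSystem G) (d : G.Dart) : R.SameFace d.symm (R.σ d) := by
  rw [← faceMap_symm]; exact R.sameFace_faceMap _

lemma SameFace.exists_pow {R : RotationSystem G} {d e : G.Dart} (h : R.SameFace d e) :
    ∃ n : ℕ, (R.faceMap ^ n) d = e := by
  classical
  exact Equiv.Perm.SameCycle.exists_nat_pow_eq h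

lemma exists_pow_of_fst (R : RotationSystem G) {d e : G.Dart} (h : d.fst = e.fst) :
    ∃ n : ℕ, (R.σ ^ n) d = e := by
  classical
  exact Equiv.Perm.SameCycle.exists_nat_pow_eq (R.orbit_tail d e h)

/-- Induction along the face orbit. -/
lemma SameFace.induction {R : RotationSystem G} {d : G.Dart} {P : G.Dart → Prop} (h0 : P d)
    (hs : ∀ x, R.SameFace d x → P x → P (R.faceMap x)) {e : G.Dart} (h : R.SameFace d e) :
    P e := by
  obtain ⟨n, rfl⟩ := h.exists_pow
  induction n with
  | zero => simpa using h0
  | succ n ih =>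
    rw [pow_succ', Equiv.Perm.mul_apply]
    exact hs _ ⟨n, by simp⟩ (ih ⟨n, by simp⟩)

/-- Induction along the rotation at a vertex. -/
lemma tail_induction (R : RotationSystem G) {d : G.Dart} {P : G.Dart → Prop} (h0 : P d)
    (hs : ∀ x, x.fst = d.fst → P x → P (R.σ x)) {e : G.Dart} (h : e.fst = d.fst) :
    P e := by
  have key : ∀ n : ℕ, ((R.σ ^ n) d).fst = d.fst ∧ P ((R.σ ^ n) d) := by
    intro n
    induction n with
    | zero => simpa using h0
    | succ n ih =>
      rw [pow_succ', Equiv.Perm.mul_apply]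
      exact ⟨(R.tail_fixed _).trans ih.1, hs _ ih.1 ih.2⟩
  obtain ⟨n, rfl⟩ := R.exists_pow_of_fst h.symm
  exact (key n).2

lemma const_of_face_invariant (R : RotationSystem G) {T : Type*} {b : G.Dart → T}
    (hb : ∀ d, b (R.faceMap d) = b d) {d e : G.Dart} (h : R.SameFace d e) : b e = b d :=
  h.induction (P := fun x => b x = b d) rfl (fun x _ hx => (hb x).trans hx)

/-- Three-connectedness as constancy of locally constant functions. -/
lemma const_off (h3 : G.ThreeConnected) {S : Set V} (hS : S.ncard ≤ 2) {T : Type*} (f : V → T)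
    (hf : ∀ x y, x ∉ S → y ∉ S → G.Adj x y → f x = f y) {x y : V} (hx : x ∉ S) (hy : y ∉ S) :
    f x = f y := by
  have hc := (h3.2 S hS).preconnected ⟨x, hx⟩ ⟨y, hy⟩
  obtain ⟨w⟩ := hc
  have : ∀ (a b : (Sᶜ : Set V)), (G.induce (Sᶜ : Set V)).Walk a b → f a = f b := by
    intro a b w
    induction w with
    | nil => rfl
    | @cons a c b h _ ih => exact (hf _ _ a.2 c.2 h).trans ih
  exact this _ _ w

lemma const_all (h3 : G.ThreeConnected) {T : Type*} (f : V → T)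
    (hf : ∀ x y, G.Adj x y → f x = f y) (x y : V) : f x = f y :=
  const_off h3 (S := ∅) (by simp) f (fun x y _ _ h => hf x y h) (by simp) (by simp)

/-- No vertex has all its neighbours in a set with at most two elements. -/
lemma exists_adj_off (h3 : G.ThreeConnected) {S : Set V} (hS : S.ncard ≤ 2) {v : V}
    (hv : v ∉ S) : ∃ w, w ∉ S ∧ G.Adj v w := by
  by_contra hcon
  push Not at hcon
  have hcard : (insert v S).ncard < Nat.card V := by
    have := Set.ncard_insert_le v S
    have := h3.1
    rw [Nat.card_eq_fintype_card]
    omega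
  obtain ⟨w, hw⟩ : ∃ w, w ∉ insert v S := by
    by_contra hall
    push Not at hall
    rw [Set.eq_univ_of_forall hall, Set.ncard_univ] at hcard
    exact lt_irrefl _ hcard
  have hw' : w ≠ v ∧ w ∉ S := by simpa [not_or] using hw
  have := const_off h3 hS (fun x => x = v) (by
    intro x y hx hy hxy
    have h1 : x ≠ v := by rintro rfl; exact hcon y hy hxy
    have h2 : y ≠ v := by rintro rfl; exact hcon x hx hxy.symm
    simp [h1, h2]) hv hw'.2
  simp only [eq_iff_iff, true_iff] at this
  exact hw'.1 this

lemma exists_dart (h3 : G.ThreeConnected) (v : V) : ∃ d : G.Dart, d.fst = v := by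
  obtain ⟨w, -, hw⟩ := exists_adj_off h3 (S := ∅) (by simp) (v := v) (by simp)
  exact ⟨⟨(v, w), hw⟩, rfl⟩

lemma σσ_ne (h3 : G.ThreeConnected) (R : RotationSystem G) (d : G.Dart) :
    R.σ (R.σ d) ≠ d := by
  intro h
  have hall : ∀ e : G.Dart, e.fst = d.fst → e = d ∨ e = R.σ d := by
    intro e he
    refine R.tail_induction (P := fun e => e = d ∨ e = R.σ d) (Or.inl rfl) ?_ he
    rintro x - (rfl | rfl)
    · exact Or.inr rfl
    · exact Or.inl h
  obtain ⟨w, hw, hadj⟩ := exists_adj_off h3 (S := {d.snd, (R.σ d).snd}) (v := d.fst)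
    ((Set.ncard_insert_le _ _).trans (by simp)) (by
      have h1 := d.adj.ne
      have h2 := (R.σ d).adj.ne
      rw [show (R.σ d).toProd.1 = d.fst from R.tail_fixed d] at h2
      simp [h1, h2])
  rcases hall ⟨(d.fst, w), hadj⟩ rfl with h | h
  · apply hw; left; rw [← h]
  · apply hw; right; rw [Set.mem_singleton_iff, ← h]

lemma σ_ne (h3 : G.ThreeConnected) (R : RotationSystem G) (d : G.Dart) : R.σ d ≠ d := by
  intro h
  exact R.σσ_ne h3 d (by rw [h, h])

/-- A function on darts invariant under rotation and reversal is constant. -/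
lemma dart_const (h3 : G.ThreeConnected) (R : RotationSystem G) {T : Type*} (f : G.Dart → T)
    (h1 : ∀ d, f (R.σ d) = f d) (h2 : ∀ d, f d.symm = f d) (d e : G.Dart) : f d = f e := by
  have htail : ∀ d e : G.Dart, e.fst = d.fst → f e = f d := fun d e h =>
    R.tail_induction (P := fun x => f x = f d) rfl (fun x _ hx => (h1 x).trans hx) h
  choose g hg using fun v => exists_dart h3 v
  have := const_all h3 (fun v => f (g v)) (by
    intro x y hxy
    have e1 : f (g x) = f ⟨(x, y), hxy⟩ := htail _ _ (hg x)
    have e2 : f (g y) = f (⟨(x, y), hxy⟩ : G.Dart).symm := htail _ _ (hg y)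
    exact e1.trans ((h2 _).symm.trans e2.symm)) d.fst e.fst
  rw [htail (g d.fst) d (hg _).symm, htail (g e.fst) e (hg _).symm]
  exact this

/-- The edge of a dart as an element of the edge set. -/
def ed (d : G.Dart) : G.edgeSet := ⟨d.edge, d.edge_mem⟩

lemma ed_eq_iff (d e : G.Dart) : ed d = ed e ↔ d = e ∨ d = e.symm := by
  simp only [ed, Subtype.mk.injEq]
  exact SimpleGraph.dart_edge_eq_iff d e

lemma ed_symm (d : G.Dart) : ed d.symm = ed d := by
  rw [ed_eq_iff]; exact Or.inr rfl

lemma exists_ed (e : G.edgeSet) : ∃ d : G.Dart, ed d = e := by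
  obtain ⟨e, he⟩ := e
  induction e using Sym2.ind with
  | _ u w => exact ⟨⟨(u, w), he⟩, rfl⟩

lemma sum_perm_invariant {D : Type*} [Fintype D] (τ : Equiv.Perm D) (w y : D → ZMod 2)
    (hw : ∀ d, w (τ d) = w d) : ∑ d, w d * (y d + y (τ⁻¹ d)) = 0 := by
  simp only [mul_add, Finset.sum_add_distrib]
  rw [zmod2_add_eq_zero, ← Equiv.sum_comp τ (fun d => w d * y (τ⁻¹ d))]
  simp [hw]

lemma euler_count {R : RotationSystem G} (hR : R.HasGenus 0) [Fintype G.edgeSet]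
    [Fintype (Quot R.SameFace)] :
    Fintype.card V + Fintype.card (Quot R.SameFace) = Fintype.card G.edgeSet + 2 := by
  have := hR
  unfold HasGenus numFaces at this
  rw [Nat.card_eq_fintype_card, Nat.card_eq_fintype_card] at this
  omega

open Matrix in
/-- The Jordan curve theorem for the radial graph of a genus zero embedding, for closed
curves through at most two vertices and two faces. -/
lemma radial_jordan (h3 : G.ThreeConnected) {R : RotationSystem G} (hR : R.HasGenus 0)
    {a a' b b' : G.Dart} (ha : a.fst = a'.fst) (hb : b.fst = b'.fst)
    (hab : R.SameFace a b) (hab' : R.SameFace a' b') :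
    ∃ g : G.Dart → ZMod 2, (∀ d, g d.symm = g d) ∧
      ∀ d, g (R.σ d) + g d = (if R.σ d = a then 1 else 0) + (if R.σ d = a' then 1 else 0) +
        (if R.σ d = b then 1 else 0) + (if R.σ d = b' then 1 else 0) := by
  classical
  let fc : G.Dart → Quot R.SameFace := Quot.mk _
  have : Fintype (Quot R.SameFace) := Fintype.ofFinite _
  let N : Matrix G.Dart G.edgeSet (ZMod 2) := Matrix.of fun d e =>
    (if ed d = e then 1 else 0) + (if ed (R.σ⁻¹ d) = e then 1 else 0)
  let M : Matrix (V ⊕ Quot R.SameFace) G.Dart (ZMod 2) := Matrix.of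
    (Sum.elim (fun v d => if d.fst = v then 1 else 0) (fun f d => if fc d = f then 1 else 0))
  have hNx : ∀ x d, (N *ᵥ x) d = x (ed d) + x (ed (R.σ⁻¹ d)) := by
    intro x d
    simp [N, Matrix.mulVec, dotProduct, add_mul, Finset.sum_add_distrib]
  have hMz : ∀ z d, (Mᵀ *ᵥ z) d = z (Sum.inl d.fst) + z (Sum.inr (fc d)) := by
    intro z d
    simp [M, Matrix.mulVec, dotProduct, Fintype.sum_sum_type]
  have hfc : ∀ d, fc (R.faceMap d) = fc d := fun d =>
    Quot.sound (R.sameFace_faceMap d).symm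
  have hedinv : ∀ d, ed (R.σ⁻¹ d) = ed (R.faceMap⁻¹ d) := by
    intro d
    have : R.faceMap (R.σ⁻¹ d).symm = d := by rw [faceMap_symm]; simp
    rw [← ed_symm, ← Equiv.Perm.eq_inv_iff_eq.2 this]
  have key := exact_of_card M N (by
      intro x
      funext z
      simp only [Pi.zero_apply]
      rcases z with v | f
      · have := sum_perm_invariant R.σ (M (Sum.inl v)) (fun d => x (ed d))
          (fun d => by simp [M, R.tail_fixed])
        rw [← this]
        simp only [Matrix.mulVec, dotProduct]
        refine Finset.sum_congr rfl fun d _ => ?_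
        rw [← hNx]; rfl
      · have := sum_perm_invariant R.faceMap (M (Sum.inr f)) (fun d => x (ed d))
          (fun d => by simp [M, hfc])
        rw [← this]
        simp only [Matrix.mulVec, dotProduct]
        refine Finset.sum_congr rfl fun d _ => ?_
        rw [← hedinv, ← hNx]; rfl)
    (by
      intro x hx
      have h1 : ∀ d, x (ed (R.σ d)) = x (ed d) := by
        intro d
        have := congrFun hx (R.σ d)
        rw [hNx] at this
        simpa [zmod2_add_eq_zero] using this
      intro i j
      obtain ⟨d, rfl⟩ := exists_ed i
      obtain ⟨e, rfl⟩ := exists_ed j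
      exact R.dart_const h3 (fun d => x (ed d)) h1 (fun d => by rw [ed_symm]) d e)
    (by
      intro z hz
      have h1 : ∀ d : G.Dart, z (Sum.inl d.fst) = z (Sum.inr (fc d)) := by
        intro d
        have := congrFun hz d
        rw [hMz] at this
        simpa [zmod2_add_eq_zero] using this
      have h2 : ∀ d : G.Dart, z (Sum.inl (R.σ d).fst) = z (Sum.inl d.fst) := by
        intro d; rw [R.tail_fixed]
      have h4 : ∀ d : G.Dart, z (Sum.inl d.symm.fst) = z (Sum.inl d.fst) := by
        intro d
        rw [← h2 d.symm, ← faceMap_apply, h1, hfc, ← h1]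
      have h5 := R.dart_const h3 (fun d => z (Sum.inl d.fst)) h2 h4
      have h6 : ∀ i, ∃ d : G.Dart, z i = z (Sum.inl d.fst) := by
        rintro (v | f)
        · obtain ⟨d, rfl⟩ := exists_dart h3 v
          exact ⟨d, rfl⟩
        · induction f using Quot.ind with
          | _ d => exact ⟨d, (h1 d).symm⟩
      intro i j
      obtain ⟨d, hd⟩ := h6 i
      obtain ⟨e, he⟩ := h6 j
      rw [hd, he]
      exact h5 d e)
    (by
      have h1 := euler_count hR
      have h2 := G.dart_card_eq_twice_card_edges
      rw [SimpleGraph.edgeFinset_card] at h2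
      rw [Fintype.card_sum]
      omega)
    (fun d => (if d = a then 1 else 0) + (if d = a' then 1 else 0) +
        (if d = b then 1 else 0) + (if d = b' then 1 else 0))
    (by
      have e1 : fc a = fc b := Quot.sound hab
      have e2 : fc a' = fc b' := Quot.sound hab'
      have htwo : (1 : ZMod 2) + 1 = 0 := by decide
      funext z
      rcases z with v | f
      · simp only [M, Matrix.mulVec, dotProduct, Matrix.of_apply, Sum.elim_inl, Pi.zero_apply,
          mul_add, Finset.sum_add_distrib, mul_ite, mul_one, mul_zero, Finset.sum_ite_eq',
          Finset.mem_univ, if_true]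
        rw [ha, hb, add_assoc, CharTwo.add_self_eq_zero, zero_add, CharTwo.add_self_eq_zero]
      · simp only [M, Matrix.mulVec, dotProduct, Matrix.of_apply, Sum.elim_inr, Pi.zero_apply,
          mul_add, Finset.sum_add_distrib, mul_ite, mul_one, mul_zero, Finset.sum_ite_eq',
          Finset.mem_univ, if_true]
        rw [e1, e2, add_assoc, add_comm (ite (fc b = f) _ _), add_assoc]
        rw [add_comm (ite (fc b = f) _ _), add_assoc, CharTwo.add_self_eq_zero, add_zero,
          CharTwo.add_self_eq_zero])
  obtain ⟨x, hx⟩ := key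
  refine ⟨fun d => x (ed d), fun d => by simp only [ed_symm], fun d => ?_⟩
  have := congrFun hx (R.σ d)
  rw [hNx] at this
  simpa using this

lemma sum_ed {A : G.Dart → ZMod 2} [Fintype G.Dart] [DecidableEq G.edgeSet] (d₀ : G.Dart) :
    ∑ d : G.Dart, (if ed d = ed d₀ then A d else 0) = A d₀ + A d₀.symm := by
  classical
  rw [← Finset.sum_filter]
  have : (Finset.univ.filter fun d : G.Dart => ed d = ed d₀) = {d₀, d₀.symm} := by
    ext d
    simp [ed_eq_iff]
  rw [this, Finset.sum_pair (SimpleGraph.Dart.symm_ne d₀).symm]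

lemma mem_edge_iff (d : G.Dart) (v : V) : v ∈ d.edge ↔ v = d.fst ∨ v = d.snd := by
  simp [SimpleGraph.Dart.edge]

lemma boundary_boundary (R : RotationSystem G) [Fintype G.Dart] [Fintype G.edgeSet]
    [DecidableEq G.edgeSet] [∀ (v : V) (e : G.edgeSet), Decidable (v ∈ (e : Sym2 V))]
    (A : G.Dart → ZMod 2)
    (hA : ∀ d, A (R.faceMap d) = A d) (v : V) :
    ∑ e : G.edgeSet, (if v ∈ (e : Sym2 V) then 1 else 0) *
      (∑ d : G.Dart, if ed d = e then A d else 0) = 0 := by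
  classical
  have h1 : ∀ e : G.edgeSet, (if v ∈ (e : Sym2 V) then 1 else 0) *
      (∑ d : G.Dart, if ed d = e then A d else 0) =
      ∑ d : G.Dart, if ed d = e then (if v ∈ (e : Sym2 V) then 1 else 0) * A d else 0 := by
    intro e
    rw [Finset.mul_sum]
    simp only [mul_ite, mul_zero]
  simp only [h1]
  rw [Finset.sum_comm]
  simp only [Finset.sum_ite_eq, Finset.mem_univ, if_true]
  have h2 : ∀ d : G.Dart, (if v ∈ ((ed d : G.edgeSet) : Sym2 V) then (1 : ZMod 2) else 0) * A d =
      (if d.fst = v then A d else 0) +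
      (if (R.faceMap d).fst = v then A (R.faceMap d) else 0) := by
    intro d
    have hne := d.adj.ne
    rw [faceMap_fst, hA]
    have : v ∈ ((ed d : G.edgeSet) : Sym2 V) ↔ v = d.fst ∨ v = d.snd := mem_edge_iff d v
    simp only [this]
    by_cases p : v = d.fst
    · subst p
      simp [hne.symm]
    · by_cases q : v = d.snd
      · subst q; simp [hne]
      · simp [p, q, Ne.symm p, Ne.symm q]
  simp only [h2]
  rw [Finset.sum_add_distrib,
    Equiv.sum_comp R.faceMap (fun d => if d.fst = v then A d else 0),
    CharTwo.add_self_eq_zero]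

open Matrix in
/-- The Jordan curve theorem for a genus zero embedding: boundaries of faces in another
rotation system are boundaries. -/
lemma jordan (h3 : G.ThreeConnected) {R : RotationSystem G} (hR : R.HasGenus 0)
    (Q : RotationSystem G) (A : G.Dart → ZMod 2) (hA : ∀ d, A (Q.faceMap d) = A d) :
    ∃ B : G.Dart → ZMod 2, (∀ d, B (R.faceMap d) = B d) ∧
      ∀ d, B d + B d.symm = A d + A d.symm := by
  classical
  let fc : G.Dart → Quot R.SameFace := Quot.mk _
  have : Fintype (Quot R.SameFace) := Fintype.ofFinite _
  have hfc : ∀ d, fc (R.faceMap d) = fc d := fun d =>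
    Quot.sound (R.sameFace_faceMap d).symm
  let N : Matrix G.edgeSet (Quot R.SameFace) (ZMod 2) := Matrix.of fun e f =>
    ∑ d : G.Dart, if ed d = e then (if fc d = f then 1 else 0) else 0
  let M : Matrix V G.edgeSet (ZMod 2) := Matrix.of fun v e =>
    if v ∈ (e : Sym2 V) then 1 else 0
  have hNx : ∀ x e, (N *ᵥ x) e = ∑ d : G.Dart, if ed d = e then x (fc d) else 0 := by
    intro x e
    simp only [N, Matrix.mulVec, dotProduct, Matrix.of_apply, Finset.sum_mul]
    rw [Finset.sum_comm]
    refine Finset.sum_congr rfl fun d _ => ?_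
    by_cases h : ed d = e <;> simp [h]
  have hMz : ∀ z (d : G.Dart), (Mᵀ *ᵥ z) (ed d) = z d.fst + z d.snd := by
    intro z d
    have hne := d.adj.ne
    simp only [M, Matrix.mulVec, dotProduct, Matrix.of_apply, Matrix.transpose_apply]
    have : ∀ v, v ∈ ((ed d : G.edgeSet) : Sym2 V) ↔ v = d.fst ∨ v = d.snd := mem_edge_iff d
    simp only [this, ite_mul, one_mul, zero_mul]
    rw [← Finset.sum_filter]
    have : (Finset.univ.filter fun v : V => v = d.fst ∨ v = d.snd) = {d.fst, d.snd} := by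
      ext v; simp
    rw [this, Finset.sum_pair hne]
  have key := exact_of_card M N (by
      intro x
      funext v
      have := R.boundary_boundary (fun d => x (fc d)) (fun d => by simp only [hfc]) v
      simp only [← hNx] at this
      exact this)
    (by
      intro x hx
      have h1 : ∀ d, x (fc d.symm) = x (fc d) := by
        intro d
        have := congrFun hx (ed d)
        rw [hNx, sum_ed, Pi.zero_apply, zmod2_add_eq_zero] at this
        exact this.symm
      have h2 := R.dart_const h3 (fun d => x (fc d)) (fun d => by
        rw [← faceMap_symm, hfc, h1]) h1
      intro i j
      induction i using Quot.ind
      induction j using Quot.ind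
      exact h2 _ _)
    (by
      intro z hz
      refine const_all h3 z ?_
      intro x y hxy
      have := congrFun hz (ed ⟨(x, y), hxy⟩)
      rw [hMz, Pi.zero_apply, zmod2_add_eq_zero] at this
      exact this)
    (by
      have h1 := euler_count hR
      omega)
    (fun e => ∑ d : G.Dart, if ed d = e then A d else 0)
    (by
      funext v
      exact Q.boundary_boundary A hA v)
  obtain ⟨x, hx⟩ := key
  refine ⟨fun d => x (fc d), fun d => by simp only [hfc], fun d => ?_⟩
  have := congrFun hx (ed d)
  rw [hNx, sum_ed, sum_ed] at this
  exact this

/-- Two dimensional colour classes off a set of at most two vertices. -/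
lemma colour_off (h3 : G.ThreeConnected) (R : RotationSystem G) {S : Set V} (hS : S.ncard ≤ 2)
    (g : G.Dart → ZMod 2) (hg : ∀ d, g d.symm = g d)
    (hσ : ∀ d : G.Dart, d.fst ∉ S → g (R.σ d) = g d) :
    ∃ c, ∀ d : G.Dart, (d.fst ∉ S ∨ d.snd ∉ S) → g d = c := by
  have htail : ∀ d e : G.Dart, d.fst ∉ S → e.fst = d.fst → g e = g d := fun d e hd h =>
    R.tail_induction (P := fun x => g x = g d) rfl
      (fun x hx' hx => (hσ x (by rwa [hx'])).trans hx) h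
  choose k hk using fun v => exists_dart h3 v
  have hconst : ∀ x y, x ∉ S → y ∉ S → g (k x) = g (k y) := by
    intro x y hx hy
    refine const_off h3 hS (fun v => g (k v)) ?_ hx hy
    intro x y hx hy hxy
    have e1 : g (k x) = g ⟨(x, y), hxy⟩ := htail _ _ hx (hk x)
    have e2 : g (k y) = g (⟨(x, y), hxy⟩ : G.Dart).symm := htail _ _ hy (hk y)
    exact e1.trans ((hg _).symm.trans e2.symm)
  by_cases hex : ∃ x, x ∉ S
  · obtain ⟨x, hx⟩ := hex
    have h1 : ∀ d : G.Dart, d.fst ∉ S → g d = g (k x) := by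
      intro d hd
      rw [← hconst d.fst x hd hx]
      exact htail _ _ (by rwa [hk]) (hk _).symm
    refine ⟨g (k x), ?_⟩
    rintro d (hd | hd)
    · exact h1 d hd
    · rw [← hg]; exact h1 d.symm hd
  · push Not at hex
    refine ⟨0, ?_⟩
    rintro d (hd | hd)
    · exact absurd (hex _) hd
    · exact absurd (hex _) hd

lemma facesSimple_of_genus_zero (h3 : G.ThreeConnected) {R : RotationSystem G}
    (hR : R.HasGenus 0) : R.FacesSimple := by
  intro d d' hf hv
  by_contra hne
  obtain ⟨g, hg1, hg2⟩ := radial_jordan h3 hR (a := d) (a' := d') (b := d) (b' := d)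
    hv rfl (R.sameFace_refl d) hf.symm
  have hg3 : ∀ x, g (R.σ x) + g x =
      (if R.σ x = d then 1 else 0) + (if R.σ x = d' then 1 else 0) := by
    intro x
    rw [hg2, add_assoc, CharTwo.add_self_eq_zero, add_zero]
  obtain ⟨c, hc⟩ := colour_off h3 R (S := {d.fst}) (by simp) g hg1 (by
    intro x hx
    have hx' : x.fst ≠ d.fst := hx
    have h1 : R.σ x ≠ d := by
      intro h; apply hx'; rw [← R.tail_fixed x, h]
    have h2 : R.σ x ≠ d' := by
      intro h; apply hx'; rw [← R.tail_fixed x, h, hv]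
    have := hg3 x
    rw [if_neg h1, if_neg h2, add_zero, zmod2_add_eq_zero] at this
    exact this)
  have hall : ∀ x : G.Dart, g x = c := by
    intro x
    apply hc
    by_cases h : x.fst = d.fst
    · right
      intro h'
      exact x.adj.ne (h.trans (show x.snd = d.fst from h').symm)
    · left; exact h
  have := hg3 (R.σ⁻¹ d)
  simp [hall, hne, CharTwo.add_self_eq_zero] at this

lemma two_faces (h3 : G.ThreeConnected) {R : RotationSystem G} (hR : R.HasGenus 0)
    {a a' b b' : G.Dart} (ha : a.fst = a'.fst) (hb : b.fst = b'.fst)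
    (hab : R.SameFace a b) (hab' : R.SameFace a' b') (hF : ¬ R.SameFace a a')
    (huw : a.fst ≠ b.fst) :
    ∃ e : G.Dart, e.fst = a.fst ∧ e.snd = b.fst ∧
      ((a = e ∧ a' = R.σ e) ∨ (a' = e ∧ a = R.σ e)) := by
  obtain ⟨g, hg1, hg2⟩ := radial_jordan h3 hR ha hb hab hab'
  have hne : a ≠ a' := by rintro rfl; exact hF (R.sameFace_refl _)
  obtain ⟨c, hc⟩ := colour_off h3 R (S := {a.fst, b.fst})
    ((Set.ncard_insert_le _ _).trans (by simp)) g hg1 (by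
    intro x hx
    simp only [Set.mem_insert_iff, Set.mem_singleton_iff, not_or] at hx
    have h : ∀ y : G.Dart, x.fst ≠ y.fst → R.σ x ≠ y := by
      rintro y hy rfl; exact hy (R.tail_fixed x).symm
    have := hg2 x
    rw [if_neg (h a hx.1), if_neg (h a' (ha ▸ hx.1)), if_neg (h b hx.2),
      if_neg (h b' (hb ▸ hx.2))] at this
    simpa [zmod2_add_eq_zero] using this)
  have hjump : ∀ y : G.Dart, y = a ∨ y = a' → g y ≠ g (R.σ⁻¹ y) := by
    intro y hy heq
    have := hg2 (R.σ⁻¹ y)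
    rw [show R.σ (R.σ⁻¹ y) = y by simp] at this
    rw [← heq, CharTwo.add_self_eq_zero] at this
    have hyf : y.fst = a.fst := by
      rcases hy with rfl | rfl
      · rfl
      · exact ha.symm
    rw [if_neg (c := y = b) (by rintro rfl; exact huw hyf.symm),
      if_neg (c := y = b') (by rintro rfl; exact huw (hyf.symm.trans hb.symm))] at this
    rcases hy with rfl | rfl
    · simp [hne] at this
    · simp [hne.symm] at this
  obtain ⟨e, he1, he2⟩ : ∃ e : G.Dart, e.fst = a.fst ∧ g e ≠ c := by
    by_contra hcon
    push Not at hcon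
    apply hjump a (Or.inl rfl)
    rw [hcon a rfl, hcon]
    rw [← R.tail_fixed]; simp
  have he3 : e.snd = b.fst := by
    by_contra h
    apply he2
    apply hc
    right
    simp only [Set.mem_insert_iff, Set.mem_singleton_iff, not_or]
    exact ⟨fun h' => e.adj.ne (he1.trans h'.symm), h⟩
  have huniq : ∀ x : G.Dart, x.fst = a.fst → x ≠ e → g x = c := by
    intro x hx hxe
    apply hc
    right
    simp only [Set.mem_insert_iff, Set.mem_singleton_iff, not_or]
    refine ⟨fun h' => x.adj.ne (hx.trans h'.symm), fun h => hxe ?_⟩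
    ext
    · exact hx.trans he1.symm
    · exact h.trans he3.symm
  have hcase : ∀ y : G.Dart, y = a ∨ y = a' → y = e ∨ y = R.σ e := by
    intro y hy
    have hyf : y.fst = a.fst := by
      rcases hy with rfl | rfl
      · rfl
      · exact ha.symm
    by_contra hcon
    push Not at hcon
    apply hjump y hy
    rw [huniq y hyf hcon.1, huniq (R.σ⁻¹ y)]
    · rw [← R.tail_fixed]; simpa using hyf
    · intro h; apply hcon.2; rw [← h]; simp
  refine ⟨e, he1, he3, ?_⟩
  rcases hcase a (Or.inl rfl) with h | h <;> rcases hcase a' (Or.inr rfl) with h' | h'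
  · exact absurd (h.trans h'.symm) hne
  · exact Or.inl ⟨h, h'⟩
  · exact Or.inr ⟨h', h⟩
  · exact absurd (h.trans h'.symm) hne

lemma faceEdges_ends {R : RotationSystem G} {d : G.Dart} {x y : V}
    (h : s(x, y) ∈ R.faceEdges d) : x ∈ R.faceVerts d ∧ y ∈ R.faceVerts d := by
  obtain ⟨e, he, hxy⟩ := h
  have h1 : e.fst ∈ R.faceVerts d := ⟨e, he, rfl⟩
  have h2 : e.snd ∈ R.faceVerts d :=
    ⟨R.faceMap e, he.trans (R.sameFace_faceMap e), R.faceMap_fst e⟩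
  have : s(e.fst, e.snd) = s(x, y) := hxy
  rw [Sym2.eq_iff] at this
  rcases this with ⟨rfl, rfl⟩ | ⟨rfl, rfl⟩
  · exact ⟨h1, h2⟩
  · exact ⟨h2, h1⟩

lemma polyhedral_of_genus_zero (h3 : G.ThreeConnected) {R : RotationSystem G}
    (hR : R.HasGenus 0) : R.Polyhedral := by
  have hs := facesSimple_of_genus_zero h3 hR
  refine ⟨hs, fun d d' hdd => ?_⟩
  by_cases hemp : R.faceVerts d ∩ R.faceVerts d' = ∅
  · exact Or.inl hemp
  right
  obtain ⟨u, hu⟩ := Set.nonempty_iff_ne_empty.2 hemp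
  by_cases hone : ∀ w ∈ R.faceVerts d ∩ R.faceVerts d', w = u
  · left
    refine ⟨u, Set.eq_singleton_iff_unique_mem.2 ⟨hu, hone⟩, ?_⟩
    rw [Set.eq_empty_iff_forall_notMem]
    intro e he
    induction e using Sym2.ind with
    | _ x y =>
      obtain ⟨h1, h2⟩ := faceEdges_ends he.1
      obtain ⟨h1', h2'⟩ := faceEdges_ends he.2
      obtain ⟨z, _, hz⟩ := he.1
      have hadj : G.Adj x y := by
        rw [← SimpleGraph.mem_edgeSet, ← hz]; exact z.edge_mem
      exact hadj.ne ((hone x ⟨h1, h1'⟩).trans (hone y ⟨h2, h2'⟩).symm)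
  right
  push Not at hone
  obtain ⟨w, hw, hwu⟩ := hone
  obtain ⟨⟨a, hda, hau⟩, ⟨a', hda', hau'⟩⟩ := hu
  have hF : ¬ R.SameFace a a' := fun h => hdd ((hda.trans h).trans hda'.symm)
  have hget : ∀ z, z ∈ R.faceVerts d ∩ R.faceVerts d' → z ≠ u →
      ∃ e : G.Dart, e.fst = u ∧ e.snd = z ∧
        ((a = e ∧ a' = R.σ e) ∨ (a' = e ∧ a = R.σ e)) := by
    rintro z ⟨⟨b, hdb, hbz⟩, ⟨b', hdb', hbz'⟩⟩ hzu
    have := two_faces h3 hR (a := a) (a' := a') (b := b) (b' := b') (hau.trans hau'.symm)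
      (hbz.trans hbz'.symm) (hda.symm.trans hdb) (hda'.symm.trans hdb') hF
      (by rw [hau, hbz]; exact hzu.symm)
    rwa [hau, hbz] at this
  obtain ⟨e, he1, he2, he3⟩ := hget w hw hwu
  have hverts : R.faceVerts d ∩ R.faceVerts d' = {u, w} := by
    ext z
    simp only [Set.mem_insert_iff, Set.mem_singleton_iff]
    constructor
    · intro hz
      by_contra hcon
      push Not at hcon
      obtain ⟨e', he1', he2', he3'⟩ := hget z hz hcon.1
      have hne : e ≠ e' := by
        rintro rfl; exact hcon.2 (he2'.symm.trans he2)
      rcases he3 with ⟨h1, h2⟩ | ⟨h1, h2⟩ <;> rcases he3' with ⟨h1', h2'⟩ | ⟨h1', h2'⟩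
      · exact hne (h1.symm.trans h1')
      · apply R.σσ_ne h3 e; rw [← h2, h1', ← h2', h1]
      · apply R.σσ_ne h3 e; rw [← h2, h1', ← h2', h1]
      · exact hne (h1.symm.trans h1')
    · rintro (rfl | rfl)
      · exact ⟨⟨a, hda, hau⟩, ⟨a', hda', hau'⟩⟩
      · exact hw
  have hadj : G.Adj u w := by
    have := e.adj
    rwa [he1, he2] at this
  have hee : e.edge = s(u, w) := by
    rw [← he1, ← he2]; rfl
  have hes : e.symm.edge = s(u, w) := by
    rw [SimpleGraph.Dart.edge_symm, hee]
  refine ⟨u, w, hadj, hverts, ?_⟩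
  ext s
  rw [Set.mem_singleton_iff]
  constructor
  · intro hs'
    induction s using Sym2.ind with
    | _ x y =>
      obtain ⟨h1, h2⟩ := faceEdges_ends hs'.1
      obtain ⟨h1', h2'⟩ := faceEdges_ends hs'.2
      obtain ⟨z, _, hz⟩ := hs'.1
      have hadj : G.Adj x y := by
        rw [← SimpleGraph.mem_edgeSet, ← hz]; exact z.edge_mem
      have hx : x ∈ ({u, w} : Set V) := hverts ▸ ⟨h1, h1'⟩
      have hy : y ∈ ({u, w} : Set V) := hverts ▸ ⟨h2, h2'⟩
      have := hadj.ne
      simp only [Set.mem_insert_iff, Set.mem_singleton_iff] at hx hy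
      rcases hx with rfl | rfl <;> rcases hy with rfl | rfl
      · exact absurd rfl this
      · rfl
      · exact Sym2.eq_swap
      · exact absurd rfl this
  · rintro rfl
    rcases he3 with ⟨h1, h2⟩ | ⟨h1, h2⟩
    · exact ⟨⟨e, h1 ▸ hda, hee⟩,
        ⟨e.symm, hda'.trans (h2 ▸ (R.sameFace_symm_σ e).symm), hes⟩⟩
    · exact ⟨⟨e.symm, hda.trans (h2 ▸ (R.sameFace_symm_σ e).symm), hes⟩,
        ⟨e, h1 ▸ hda', hee⟩⟩

lemma symm_not_sameFace (h3 : G.ThreeConnected) {Q : RotationSystem G} (hQ : Q.FacesSimple)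
    (d : G.Dart) : ¬ Q.SameFace d d.symm := by
  intro h
  have := hQ (Q.faceMap d) d.symm ((Q.sameFace_faceMap d).symm.trans h) (Q.faceMap_fst d)
  exact Q.σ_ne h3 d.symm this

/-- Facial cycles of polyhedral embeddings are induced. -/
lemma face_induced {Q : RotationSystem G} (hQ : Q.Polyhedral) {d x : G.Dart}
    (h1 : x.fst ∈ Q.faceVerts d) (h2 : x.snd ∈ Q.faceVerts d) :
    Q.SameFace d x ∨ Q.SameFace d x.symm := by
  by_cases hx : Q.SameFace d x
  · exact Or.inl hx
  have h1' : x.fst ∈ Q.faceVerts x := ⟨x, Q.sameFace_refl x, rfl⟩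
  have h2' : x.snd ∈ Q.faceVerts x := ⟨Q.faceMap x, Q.sameFace_faceMap x, Q.faceMap_fst x⟩
  have hne : x.fst ≠ x.snd := x.adj.ne
  rcases hQ.2 d x hx with h | ⟨v, h, -⟩ | ⟨u, w, -, h, h'⟩
  · exact absurd h (Set.nonempty_iff_ne_empty.1 ⟨x.fst, h1, h1'⟩)
  · have e1 : x.fst ∈ ({v} : Set V) := h ▸ ⟨h1, h1'⟩
    have e2 : x.snd ∈ ({v} : Set V) := h ▸ ⟨h2, h2'⟩
    exact absurd ((Set.mem_singleton_iff.1 e1).trans (Set.mem_singleton_iff.1 e2).symm) hne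
  · have e1 : x.fst ∈ ({u, w} : Set V) := h ▸ ⟨h1, h1'⟩
    have e2 : x.snd ∈ ({u, w} : Set V) := h ▸ ⟨h2, h2'⟩
    have e3 : x.edge = s(u, w) := by
      change s(x.fst, x.snd) = s(u, w)
      simp only [Set.mem_insert_iff, Set.mem_singleton_iff] at e1 e2
      rw [Sym2.eq_iff]
      grind
    have e4 : s(u, w) ∈ Q.faceEdges d := by
      have : s(u, w) ∈ Q.faceEdges d ∩ Q.faceEdges x := by rw [h']; rfl
      exact this.1
    obtain ⟨y, hy, hyx⟩ := e4
    rw [← e3, SimpleGraph.dart_edge_eq_iff] at hyx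
    rcases hyx with rfl | rfl
    · exact Or.inl hy
    · exact Or.inr hy

/-- A face other than a given one is, off the given face, connected. -/
lemma face_minus_const {Q : RotationSystem G} (hQ : Q.Polyhedral) {d x : G.Dart} {T : Type*}
    {c : V → T}
    (hc : ∀ p q, p ∉ Q.faceVerts d → q ∉ Q.faceVerts d → G.Adj p q → c p = c q)
    (hx : ¬ Q.SameFace d x) (hxv : x.fst ∈ Q.faceVerts d) :
    ∃ t, ∀ z, Q.SameFace x z → z.fst ∉ Q.faceVerts d → c z.fst = t := by
  have hxx : x.fst ∈ Q.faceVerts x := ⟨x, Q.sameFace_refl x, rfl⟩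
  -- the distinguished dart `y` after which the face leaves the given face
  obtain ⟨y, hxy, hyK, hy⟩ : ∃ y, Q.SameFace x y ∧ y.fst ∈ Q.faceVerts d ∧
      ∀ z, Q.SameFace x z → z.fst ∈ Q.faceVerts d → z = y ∨ z = Q.faceMap y := by
    rcases hQ.2 d x hx with h | ⟨v, h, -⟩ | ⟨u, w, -, h, h'⟩
    · exact absurd h (Set.nonempty_iff_ne_empty.1 ⟨x.fst, hxv, hxx⟩)
    · refine ⟨x, Q.sameFace_refl x, hxv, fun z hz hzK => Or.inl ?_⟩
      have e1 : x.fst ∈ ({v} : Set V) := h ▸ ⟨hxv, hxx⟩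
      have e2 : z.fst ∈ ({v} : Set V) := h ▸ ⟨hzK, ⟨z, hz, rfl⟩⟩
      exact hQ.1 z x hz.symm
        ((Set.mem_singleton_iff.1 e2).trans (Set.mem_singleton_iff.1 e1).symm)
    · have e4 : s(u, w) ∈ Q.faceEdges d ∩ Q.faceEdges x := by rw [h']; rfl
      obtain ⟨y, hy, hyx⟩ := e4.2
      have e5 : s(y.fst, y.snd) = s(u, w) := hyx
      have e6 : y.fst ∈ Q.faceVerts d := by
        rw [← e5] at e4
        exact (faceEdges_ends e4.1).1
      refine ⟨y, hy, e6, fun z hz hzK => ?_⟩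
      have e2 : z.fst ∈ ({u, w} : Set V) := h ▸ ⟨hzK, ⟨z, hz, rfl⟩⟩
      have e7 : z.fst = y.fst ∨ z.fst = y.snd := by
        simp only [Set.mem_insert_iff, Set.mem_singleton_iff] at e2
        rw [Sym2.eq_iff] at e5
        grind
      rcases e7 with e | e
      · exact Or.inl (hQ.1 z y (hz.symm.trans hy) e)
      · exact Or.inr (hQ.1 z _ ((hz.symm.trans hy).trans (Q.sameFace_faceMap y))
          (e.trans (Q.faceMap_fst y).symm))
  refine ⟨c (Q.faceMap⁻¹ y).fst, fun z hz hzK => ?_⟩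
  obtain ⟨n, hn⟩ := (hz.symm.trans hxy).exists_pow
  induction n generalizing z with
  | zero =>
    rw [pow_zero, Equiv.Perm.one_apply] at hn
    rw [hn] at hzK
    exact absurd hyK hzK
  | succ n ih =>
    by_cases hK : (Q.faceMap z).fst ∈ Q.faceVerts d
    · rcases hy _ (hz.trans (Q.sameFace_faceMap z)) hK with h | h
      · rw [← h]; simp
      · have := Q.faceMap.injective h
        rw [this] at hzK
        exact absurd hyK hzK
    · rw [← ih (Q.faceMap z) (hz.trans (Q.sameFace_faceMap z)) hK
        (by rw [← hn, pow_succ, Equiv.Perm.mul_apply])]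
      refine hc _ _ hzK hK ?_
      rw [Q.faceMap_fst]
      exact z.adj

/-- The neighbourhood of a facial cycle of a polyhedral embedding is connected. -/
lemma around_face (h3 : G.ThreeConnected) {Q : RotationSystem G} (hQ : Q.Polyhedral)
    {d : G.Dart} {T : Type*} {c : V → T}
    (hc : ∀ p q, p ∉ Q.faceVerts d → q ∉ Q.faceVerts d → G.Adj p q → c p = c q) :
    ∃ t, ∀ x : G.Dart, x.fst ∈ Q.faceVerts d → x.snd ∉ Q.faceVerts d → c x.snd = t := by
  have hσd : ∀ e, Q.SameFace d e → ¬ Q.SameFace d (Q.σ e) := by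
    intro e he h
    exact symm_not_sameFace h3 hQ.1 e
      (he.symm.trans (h.trans (Q.sameFace_symm_σ e).symm))
  obtain ⟨t, ht⟩ := face_minus_const hQ hc (hσd d (Q.sameFace_refl d))
    (by rw [Q.tail_fixed]; exact ⟨d, Q.sameFace_refl d, rfl⟩)
  let good : G.Dart → Prop := fun x => ∀ z, Q.SameFace x z → z.fst ∉ Q.faceVerts d → c z.fst = t
  have hgood_face : ∀ x y, Q.SameFace x y → good x → good y := fun x y hxy hx z hz =>
    hx z (hxy.trans hz)
  have hstep : ∀ x : G.Dart, x.fst ∈ Q.faceVerts d → x.snd ∉ Q.faceVerts d → good x →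
      good (Q.σ x) := by
    intro x hx1 hx2 hg
    have e1 : c x.snd = t := by
      have := hg (Q.faceMap x) (Q.sameFace_faceMap x) (by rwa [Q.faceMap_fst])
      rwa [Q.faceMap_fst] at this
    have hns : ¬ Q.SameFace d (Q.σ x) := by
      intro h
      exact hx2 ⟨x.symm, h.trans (Q.sameFace_symm_σ x).symm, rfl⟩
    obtain ⟨t', ht'⟩ := face_minus_const hQ hc hns (by rwa [Q.tail_fixed])
    have e2 : c x.snd = t' := ht' x.symm (Q.sameFace_symm_σ x).symm hx2
    intro z hz hzK
    rw [ht' z hz hzK, ← e2, e1]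
  have hvertex : ∀ e, Q.SameFace d e → good (Q.σ e) → ∀ x : G.Dart, x.fst = e.fst →
      x = e ∨ good x := by
    intro e he hg x hx
    refine Q.tail_induction (P := fun x => x = e ∨ good x) (Or.inl rfl) ?_ hx
    rintro y hy (rfl | hgy)
    · exact Or.inr hg
    · by_cases h1 : y = e
      · rw [h1]; exact Or.inr hg
      by_cases h2 : Q.σ y = e
      · exact Or.inl h2
      right
      have hyK : y.fst ∈ Q.faceVerts d := ⟨e, he, hy.symm⟩
      refine hstep y hyK ?_ hgy
      intro hy2
      rcases face_induced hQ hyK hy2 with h | h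
      · exact h1 (hQ.1 y e (h.symm.trans he) hy)
      · apply h2
        refine hQ.1 _ _ ((h.trans (Q.sameFace_symm_σ y)).symm.trans he) ?_
        rw [Q.tail_fixed]; exact hy
  have hback : ∀ e, Q.SameFace d e → good (Q.σ (Q.faceMap e)) → good (Q.σ e) := by
    intro e he hg
    rcases hvertex (Q.faceMap e) (he.trans (Q.sameFace_faceMap e)) hg e.symm
      (Q.faceMap_fst e).symm with h | h
    · exact absurd h.symm (Q.σ_ne h3 e.symm)
    · exact hgood_face _ _ (Q.sameFace_symm_σ e) h
  have hall : ∀ e, Q.SameFace d e → good (Q.σ e) := by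
    intro e he
    obtain ⟨n, hn⟩ := he.symm.exists_pow
    induction n generalizing e with
    | zero =>
      rw [pow_zero, Equiv.Perm.one_apply] at hn
      rw [hn]; exact ht
    | succ n ih =>
      refine hback e he (ih _ (he.trans (Q.sameFace_faceMap e)) ?_)
      rw [← hn, pow_succ, Equiv.Perm.mul_apply]
  refine ⟨t, fun x hx1 hx2 => ?_⟩
  obtain ⟨e, he, hex⟩ := hx1
  rcases hvertex e he (hall e he) x hex.symm with rfl | h
  · exact absurd ⟨Q.faceMap x, he.trans (Q.sameFace_faceMap x), Q.faceMap_fst x⟩ hx2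
  · have := h (Q.faceMap x) (Q.sameFace_faceMap x) (by rwa [Q.faceMap_fst])
    rwa [Q.faceMap_fst] at this

/-- Facial cycles of a polyhedral embedding are nonseparating. -/
lemma face_nonseparating (h3 : G.ThreeConnected) {Q : RotationSystem G} (hQ : Q.Polyhedral)
    {d : G.Dart} {T : Type*} {c : V → T}
    (hc : ∀ p q, p ∉ Q.faceVerts d → q ∉ Q.faceVerts d → G.Adj p q → c p = c q) :
    ∃ t, ∀ v, v ∉ Q.faceVerts d → c v = t := by
  obtain ⟨t, ht⟩ := around_face h3 hQ hc
  refine ⟨t, fun v hv => ?_⟩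
  by_contra hne
  have := const_all h3 (fun x => x ∉ Q.faceVerts d ∧ c x ≠ t) (by
    have key : ∀ x y, G.Adj x y → (x ∉ Q.faceVerts d ∧ c x ≠ t) →
        (y ∉ Q.faceVerts d ∧ c y ≠ t) := by
      rintro x y hxy ⟨h1, h2⟩
      have hy : y ∉ Q.faceVerts d := by
        intro hy
        exact h2 (ht ⟨(y, x), hxy.symm⟩ hy h1)
      exact ⟨hy, by rwa [← hc x y h1 hy hxy]⟩
    intro x y hxy
    exact propext ⟨key x y hxy, key y x hxy.symm⟩) v d.fst
  have h := this.mp ⟨hv, hne⟩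
  exact h.1 ⟨d, Q.sameFace_refl d, rfl⟩

/-- Every face of a polyhedral embedding is a face of each genus zero embedding, up to
reversal. -/
lemma face_rigid (h3 : G.ThreeConnected) {R Q : RotationSystem G} (hR : R.HasGenus 0)
    (hQ : Q.Polyhedral) (d : G.Dart) :
    (∀ x, Q.SameFace d x → R.σ x.symm = Q.σ x.symm) ∨
    (∀ x, Q.SameFace d x → Q.σ (R.σ x) = x) := by
  classical
  obtain ⟨B, hB1, hB2⟩ := jordan h3 hR Q (fun x => if Q.SameFace d x then 1 else 0) (by
    intro x
    have : Q.SameFace d (Q.faceMap x) ↔ Q.SameFace d x :=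
      ⟨fun h => h.trans (Q.sameFace_faceMap x).symm, fun h => h.trans (Q.sameFace_faceMap x)⟩
    simp only [this])
  have hBsymm : ∀ x, ¬ Q.SameFace d x → ¬ Q.SameFace d x.symm → B x.symm = B x := by
    intro x h1 h2
    have := hB2 x
    simp only [h1, h2, if_false, add_zero] at this
    exact (zmod2_add_eq_zero.1 this).symm
  have hoff : ∀ x : G.Dart, x.fst ∉ Q.faceVerts d →
      ¬ Q.SameFace d x ∧ ¬ Q.SameFace d x.symm := by
    intro x hx
    refine ⟨fun h => hx ⟨x, h, rfl⟩, fun h => hx ?_⟩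
    exact ⟨Q.faceMap x.symm, h.trans (Q.sameFace_faceMap _), Q.faceMap_fst _⟩
  have htail : ∀ x y : G.Dart, x.fst ∉ Q.faceVerts d → y.fst = x.fst → B y = B x := by
    intro x y hx hy
    refine R.tail_induction (P := fun y => B y = B x) rfl ?_ hy
    intro z hz hzB
    obtain ⟨h1, h2⟩ := hoff z (by rwa [hz])
    rw [← faceMap_symm, hB1, hBsymm z h1 h2, hzB]
  choose k hk using fun v => exists_dart h3 v
  obtain ⟨t, ht⟩ := face_nonseparating h3 hQ (d := d) (c := fun v => B (k v)) (by
    intro p q hp hq hpq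
    let e : G.Dart := ⟨(p, q), hpq⟩
    have e1 : B (k p) = B e := htail e _ hp (hk p)
    have e2 : B (k q) = B e.symm := htail e.symm _ hq (hk q)
    obtain ⟨h1, h2⟩ := hoff e hp
    exact e1.trans ((hBsymm e h1 h2).symm.trans e2.symm))
  have hon0 : ∀ x : G.Dart, B x ≠ t → x.fst ∈ Q.faceVerts d := by
    intro x hx
    by_contra h
    apply hx
    rw [← ht x.fst h]
    exact (htail x _ h (hk _)).symm
  have hon : ∀ x : G.Dart, B x ≠ t → Q.SameFace d x ∨ Q.SameFace d x.symm := by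
    intro x hx
    refine face_induced hQ (hon0 x hx) ?_
    have := hon0 (R.faceMap x) (by rwa [hB1])
    rwa [R.faceMap_fst] at this
  have hflip : ∀ x, Q.SameFace d x → B x = t → B x.symm ≠ t := by
    intro x hx h1 h2
    have h3' : ¬ Q.SameFace d x.symm := fun h =>
      symm_not_sameFace h3 hQ.1 x (hx.symm.trans h)
    have := hB2 x
    simp [hx, h3', h1, h2, CharTwo.add_self_eq_zero] at this
  have hstep : ∀ x, Q.SameFace d x → B x ≠ t → R.faceMap x = Q.faceMap x := by
    intro x hx hxB
    rcases hon (R.faceMap x) (by rwa [hB1]) with h | h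
    · exact hQ.1 _ _ (h.symm.trans (hx.trans (Q.sameFace_faceMap x)))
        ((R.faceMap_fst x).trans (Q.faceMap_fst x).symm)
    · have h1 : Q.faceMap (R.faceMap x).symm = Q.faceMap x := by
        refine hQ.1 _ _ ((h.trans (Q.sameFace_faceMap _)).symm.trans
          (hx.trans (Q.sameFace_faceMap x))) ?_
        rw [Q.faceMap_fst, Q.faceMap_fst]
        exact R.faceMap_fst x
      have h2 := Q.faceMap.injective h1
      have h4 : R.faceMap x = x.symm := by
        rw [← SimpleGraph.Dart.symm_symm (R.faceMap x), h2]
      exact absurd h4 (R.σ_ne h3 x.symm)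
  by_cases hex : ∃ x, Q.SameFace d x ∧ B x ≠ t
  · left
    obtain ⟨x₀, hx₀, hB₀⟩ := hex
    intro x hx
    have hBx : B x ≠ t := by
      refine SameFace.induction (R := Q) (d := x₀) (P := fun x => B x ≠ t) hB₀ ?_
        (hx₀.symm.trans hx)
      intro y hy hyB
      rw [← hstep y (hx₀.trans hy) hyB, hB1]
      exact hyB
    exact hstep x hx hBx
  · right
    push Not at hex
    intro x hx
    have h1 : B (R.σ x) ≠ t := by
      rw [← faceMap_symm, hB1]
      exact hflip x hx (hex x hx)
    rcases hon _ h1 with h | h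
    · exact absurd (hex _ h) h1
    · refine hQ.1 _ _ ((h.trans (Q.sameFace_symm_σ _)).symm.trans hx) ?_
      rw [Q.tail_fixed, R.tail_fixed]

lemma rigid (h3 : G.ThreeConnected) {R Q : RotationSystem G} (hR : R.HasGenus 0)
    (hQ : Q.Polyhedral) : Q.σ = R.σ ∨ Q.σ = R.σ⁻¹ := by
  let P : G.Dart → Prop := fun d => ∀ x, Q.SameFace d x → R.σ x.symm = Q.σ x.symm
  have hface : ∀ d e, Q.SameFace d e → P d → P e := fun d e h hd x hx => hd x (h.trans hx)
  have hsymm : ∀ d, P d → P d.symm := by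
    intro d hd
    rcases face_rigid h3 hR hQ d.symm with h | h
    · exact h
    · have h1 := hd d (Q.sameFace_refl d)
      have h2 := h d.symm (Q.sameFace_refl _)
      rw [h1] at h2
      exact absurd h2 (Q.σσ_ne h3 _)
  have hinv1 : ∀ d, P d.symm = P d := by
    intro d
    refine propext ⟨fun h => ?_, hsymm d⟩
    have := hsymm _ h
    rwa [SimpleGraph.Dart.symm_symm] at this
  have hinv2 : ∀ d, P (Q.σ d) = P d := by
    intro d
    rw [← hinv1 d]
    exact propext ⟨hface _ _ (Q.sameFace_symm_σ d).symm, hface _ _ (Q.sameFace_symm_σ d)⟩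
  have hconst := Q.dart_const h3 P hinv2 hinv1
  by_cases hP : ∃ d, P d
  · left
    obtain ⟨d, hd⟩ := hP
    ext1 x
    have : P x.symm := (hconst d x.symm).mp hd
    have := this _ (Q.sameFace_refl _)
    rw [SimpleGraph.Dart.symm_symm] at this
    exact this.symm
  · right
    push Not at hP
    have h1 : ∀ x, Q.σ (R.σ x) = x := by
      intro x
      rcases face_rigid h3 hR hQ x with h | h
      · exact absurd h (hP x)
      · exact h x (Q.sameFace_refl x)
    ext1 x
    have := h1 (R.σ⁻¹ x)
    simpa using this

lemma genus_of_inverse {R Q : RotationSystem G} (h : Q.σ = R.σ⁻¹) (hR : R.HasGenus 0) :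
    Q.HasGenus 0 := by
  have hconj : Q.faceMap = dartSymmPerm G * R.faceMap⁻¹ * (dartSymmPerm G)⁻¹ := by
    have e1 : Q.faceMap = Q.σ * dartSymmPerm G := rfl
    have e2 : R.faceMap = R.σ * dartSymmPerm G := rfl
    rw [e1, e2, h]
    group
    rw [show ((dartSymmPerm G) ^ (-1 : ℤ)) = dartSymmPerm G from rfl]
  have hsame : ∀ x y, Q.SameFace x y ↔ R.SameFace x.symm y.symm := by
    intro x y
    unfold SameFace
    rw [hconj, Equiv.Perm.sameCycle_conj, Equiv.Perm.sameCycle_inv]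
    rfl
  have hcard : Q.numFaces = R.numFaces := by
    unfold numFaces
    exact Nat.card_congr (Quot.congr (dartSymmPerm G) hsame)
  unfold HasGenus at *
  rw [hcard]
  exact hR

lemma genus_of_eq {R Q : RotationSystem G} (h : Q.σ = R.σ) (hR : R.HasGenus 0) :
    Q.HasGenus 0 := by
  cases R; cases Q
  cases h
  exact hR

end RotationSystem

/-- A 3-connected planar graph has a polyhedral plane embedding which is, up to
mirror images, its unique plane embedding and its unique polyhedral embedding. -/
theorem threeConnected_planar_unique_polyhedral
    {V : Type*} [Fintype V] [DecidableEq V] {G : SimpleGraph V}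
    (h3 : G.ThreeConnected) (hplanar : ∃ R : RotationSystem G, R.HasGenus 0) :
    (∀ R : RotationSystem G, R.HasGenus 0 → R.Polyhedral) ∧
    (∀ R₁ R₂ : RotationSystem G, R₁.HasGenus 0 → R₂.HasGenus 0 →
      R₁.σ = R₂.σ ∨ R₁.σ = (R₂.σ)⁻¹) ∧
    (∀ R : RotationSystem G, R.Polyhedral → R.HasGenus 0) := by
  obtain ⟨R₀, hR₀⟩ := hplanar
  refine ⟨fun R hR => RotationSystem.polyhedral_of_genus_zero h3 hR, fun R₁ R₂ h1 h2 =>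
    RotationSystem.rigid h3 h2 (RotationSystem.polyhedral_of_genus_zero h3 h1), fun R hR => ?_⟩
  rcases RotationSystem.rigid h3 hR₀ hR with h | h
  · exact RotationSystem.genus_of_eq h hR₀
  · exact RotationSystem.genus_of_inverse h hR₀
end

section
/- Let σ be a polyhedral embedding of a cubic graph G and let C be an induced 6-cycle of G. Then either C is a facial cycle of σ (one of its two orientations is a facial walk), or exactly 3 darts not on C with tails on C are left of C and exactly 3 are right of C; moreover, in the latter case, for each of the two sides, the three tails on C of the darts leaving C to that side do not form a path of length 2 in C. -/
open SimpleGraph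

/-- A directed simple cycle of length `k` in `G`: a cyclic sequence of darts,
each ending where the next one starts, with pairwise distinct tails. -/
structure DirCycle {V : Type*} (G : SimpleGraph V) (k : ℕ) where
  darts : ZMod k → G.Dart
  chain : ∀ i : ZMod k, (darts i).snd = (darts (i + 1)).fst
  inj : Function.Injective fun i : ZMod k => (darts i).fst

namespace DirCycle

variable {V : Type*} {G : SimpleGraph V} {k : ℕ}

/-- The vertex set of a directed cycle. -/
def vertices (c : DirCycle G k) : Set V :=
  Set.range fun i : ZMod k => (c.darts i).fst

/-- The edge set of a directed cycle. -/
def edges (c : DirCycle G k) : Set (Sym2 V) :=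
  Set.range fun i : ZMod k => (c.darts i).edge

/-- A cycle is induced if every edge of `G` with both endpoints on the cycle is
an edge of the cycle. -/
def Induced (c : DirCycle G k) : Prop :=
  ∀ u w : V, G.Adj u w → u ∈ c.vertices → w ∈ c.vertices → s(u, w) ∈ c.edges

end DirCycle

namespace RotationSystem

variable {V : Type*} [Fintype V] [DecidableEq V] {G : SimpleGraph V} {k : ℕ}

/-- The directed cycle `C` is a facial walk of the embedding. -/
def IsFaceOf (R : RotationSystem G) (c : DirCycle G k) : Prop :=
  ∀ i : ZMod k, R.faceMap (c.darts i) = c.darts (i + 1)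

/-- The reversed directed cycle `C⁻¹` is a facial walk of the embedding. -/
def IsReverseFaceOf (R : RotationSystem G) (c : DirCycle G k) : Prop :=
  ∀ i : ZMod k, R.faceMap ((c.darts (i + 1)).symm) = (c.darts i).symm

/-- The (undirected) cycle underlying `C` is a facial cycle: one of its two
orientations is a facial walk. -/
def IsFacialCycle (R : RotationSystem G) (c : DirCycle G k) : Prop :=
  R.IsFaceOf c ∨ R.IsReverseFaceOf c

/-- In the cyclic order obtained by iterating `σ` from `b`, the element `x` occurs
(strictly after `b`) before `y` occurs. -/
def OccursBefore (σ : Equiv.Perm G.Dart) (b x y : G.Dart) : Prop :=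
  ∃ m : ℕ, 0 < m ∧ (σ ^ m) b = x ∧ ∀ l : ℕ, 0 < l → l ≤ m → (σ ^ l) b ≠ y

/-- The dart `e`, with tail the `i`-th vertex of the directed cycle `c` and not one
of the two darts of `c` at that vertex, leaves `c` to the right: in the rotation at
the `i`-th vertex it occurs after the outgoing cycle dart and before the inverse of
the incoming cycle dart. -/
def IsRightDartAt (R : RotationSystem G) (c : DirCycle G k) (i : ZMod k) (e : G.Dart) : Prop :=
  e.fst = (c.darts i).fst ∧ e ≠ c.darts i ∧ e ≠ (c.darts (i - 1)).symm ∧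
    OccursBefore R.σ (c.darts i) e ((c.darts (i - 1)).symm)

/-- The dart `e`, with tail the `i`-th vertex of the directed cycle `c` and not one
of the two darts of `c` at that vertex, leaves `c` to the left. -/
def IsLeftDartAt (R : RotationSystem G) (c : DirCycle G k) (i : ZMod k) (e : G.Dart) : Prop :=
  e.fst = (c.darts i).fst ∧ e ≠ c.darts i ∧ e ≠ (c.darts (i - 1)).symm ∧
    ¬ OccursBefore R.σ (c.darts i) e ((c.darts (i - 1)).symm)

/-- Position `i + 1` starts a maximal run of vertices of `c` having no dart leaving
`c` to the left; each such run corresponds to one left facial subpath of `c`. -/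
def LeftSubpathStart (R : RotationSystem G) (c : DirCycle G k) (i : ZMod k) : Prop :=
  (∃ e : G.Dart, R.IsLeftDartAt c i e) ∧ ¬ ∃ e : G.Dart, R.IsLeftDartAt c (i + 1) e

/-- Position `i + 1` starts a maximal run of vertices of `c` having no dart leaving
`c` to the right; each such run corresponds to one right facial subpath of `c`. -/
def RightSubpathStart (R : RotationSystem G) (c : DirCycle G k) (i : ZMod k) : Prop :=
  (∃ e : G.Dart, R.IsRightDartAt c i e) ∧ ¬ ∃ e : G.Dart, R.IsRightDartAt c (i + 1) e

end RotationSystem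


namespace HexAux

open RotationSystem

variable {V : Type*} [Fintype V] [DecidableEq V] {G : SimpleGraph V}

/-- The three darts at a vertex of a cubic graph form a 3-cycle of the rotation. -/
lemma rot3 (hG : G.IsCubic) (R : RotationSystem G) (d : G.Dart) :
    R.σ d ≠ d ∧ R.σ (R.σ d) ≠ d ∧ R.σ (R.σ (R.σ d)) = d ∧
      ∀ e : G.Dart, e.fst = d.fst → e = d ∨ e = R.σ d ∨ e = R.σ (R.σ d) := by
  classical
  have hcard : (Finset.univ.filter (fun e : G.Dart => e.fst = d.fst)).card = 3 := by
    have h1 := G.dart_fst_fiber_card_eq_degree d.fst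
    have h2 := hG d.fst
    rw [Nat.card_eq_fintype_card, G.card_neighborSet_eq_degree] at h2
    rw [h2] at h1
    exact h1
  have hpow : ∀ e : G.Dart, e.fst = d.fst → ∃ n : ℕ, (R.σ ^ n) d = e := by
    intro e he
    obtain ⟨n, -, hn⟩ := (R.orbit_tail d e he.symm).exists_pow_eq'
    exact ⟨n, hn⟩
  have hmem : ∀ e : G.Dart, e ∈ Finset.univ.filter (fun e : G.Dart => e.fst = d.fst) ↔
      e.fst = d.fst := by simp
  have h2 : R.σ (R.σ d) ≠ d := by
    intro h
    have hall : ∀ n : ℕ, (R.σ ^ n) d = d ∨ (R.σ ^ n) d = R.σ d := by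
      intro n
      induction n with
      | zero => left; rfl
      | succ k ih =>
        rw [pow_succ', Equiv.Perm.mul_apply]
        rcases ih with ih | ih <;> rw [ih]
        · right; rfl
        · left; exact h
    have hsub : Finset.univ.filter (fun e : G.Dart => e.fst = d.fst) ⊆ {d, R.σ d} := by
      intro e he
      obtain ⟨n, hn⟩ := hpow e ((hmem e).1 he)
      rcases hall n with h' | h' <;> rw [← hn, h'] <;> simp
    have := (Finset.card_le_card hsub).trans Finset.card_le_two
    omega
  have h1 : R.σ d ≠ d := by
    intro h
    exact h2 (by rw [h, h])
  have hS : ({d, R.σ d, R.σ (R.σ d)} : Finset G.Dart) =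
      Finset.univ.filter (fun e : G.Dart => e.fst = d.fst) := by
    apply Finset.eq_of_subset_of_card_le
    · intro e he
      simp only [Finset.mem_insert, Finset.mem_singleton] at he
      rw [hmem]
      rcases he with rfl | rfl | rfl <;> simp [R.tail_fixed]
    · rw [hcard, Finset.card_eq_three.2 ⟨d, R.σ d, R.σ (R.σ d), h1.symm, h2.symm, ?_, rfl⟩]
      intro h
      exact h1 (R.σ.injective h.symm)
  have hall : ∀ e : G.Dart, e.fst = d.fst → e = d ∨ e = R.σ d ∨ e = R.σ (R.σ d) := by
    intro e he
    have := (hmem e).2 he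
    rw [← hS] at this
    simpa using this
  refine ⟨h1, h2, ?_, hall⟩
  rcases hall (R.σ (R.σ (R.σ d))) (by simp [R.tail_fixed]) with h | h | h
  · exact h
  · exact absurd (R.σ.injective h) h2
  · exact absurd (R.σ.injective (R.σ.injective h)) h1

/-- The `i`-th vertex. -/
def vtx (c : DirCycle G 6) (i : ZMod 6) : V := (c.darts i).fst

/-- Left turn-free position: the rotation sends the outgoing dart to the reversed incoming one. -/
def B (R : RotationSystem G) (c : DirCycle G 6) (i : ZMod 6) : Prop :=
  R.σ (c.darts i) = (c.darts (i - 1)).symm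

/-- Mirror image of `B`. -/
def A (R : RotationSystem G) (c : DirCycle G 6) (i : ZMod 6) : Prop :=
  R.σ ((c.darts (i - 1)).symm) = c.darts i

lemma vinj (c : DirCycle G 6) {i j : ZMod 6} (h : vtx c i = vtx c j) : i = j := c.inj h

lemma snd_eq (c : DirCycle G 6) (i : ZMod 6) : (c.darts i).snd = vtx c (i + 1) := c.chain i

lemma back_fst (c : DirCycle G 6) (i : ZMod 6) :
    ((c.darts (i - 1)).symm).fst = vtx c i := by
  have := c.chain (i - 1)
  rw [sub_add_cancel] at this
  exact this

lemma out_ne_back (c : DirCycle G 6) (i : ZMod 6) : c.darts i ≠ (c.darts (i - 1)).symm := by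
  intro h
  have h1 := congrArg (fun d : G.Dart => d.snd) h
  have h2 : vtx c (i + 1) = vtx c (i - 1) := by
    rw [← snd_eq]; exact h1
  have h3 := vinj c h2
  exact (by decide : ∀ i : ZMod 6, i + 1 ≠ i - 1) i h3

lemma A_or_B (hG : G.IsCubic) (R : RotationSystem G) (c : DirCycle G 6) (i : ZMod 6) :
    A R c i ∨ B R c i := by
  obtain ⟨-, -, h3, hall⟩ := rot3 hG R (c.darts i)
  rcases hall _ (back_fst c i) with h | h | h
  · exact absurd h.symm (out_ne_back c i)
  · right; exact h.symm
  · left; unfold A; rw [h, h3]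

lemma not_A_and_B (hG : G.IsCubic) (R : RotationSystem G) (c : DirCycle G 6) (i : ZMod 6) :
    ¬ (A R c i ∧ B R c i) := by
  rintro ⟨hA, hB⟩
  obtain ⟨-, h2, -, -⟩ := rot3 hG R (c.darts i)
  unfold A at hA
  unfold B at hB
  rw [← hB] at hA
  exact h2 hA

lemma right_iff (hG : G.IsCubic) (R : RotationSystem G) (c : DirCycle G 6) (i : ZMod 6)
    (e : G.Dart) : R.IsRightDartAt c i e ↔ ¬ B R c i ∧ e = R.σ (c.darts i) := by
  obtain ⟨h1, h2, h3, hall⟩ := rot3 hG R (c.darts i)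
  constructor
  · rintro ⟨hf, hne, hnb, m, hm, hme, hl⟩
    have hB : ¬ B R c i := fun hB => hl 1 one_pos hm (by rw [pow_one]; exact hB)
    refine ⟨hB, ?_⟩
    have hA := (A_or_B hG R c i).resolve_right hB
    rcases hall e hf with h | h | h
    · exact absurd h hne
    · exact h
    · exfalso
      apply hnb
      rw [h]
      apply R.σ.injective
      rw [h3]
      exact hA.symm
  · rintro ⟨hB, rfl⟩
    refine ⟨R.tail_fixed _, h1, hB, 1, one_pos, by rw [pow_one], ?_⟩
    intro l hl hl'
    obtain rfl : l = 1 := by omega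
    rw [pow_one]
    exact hB

lemma left_iff (hG : G.IsCubic) (R : RotationSystem G) (c : DirCycle G 6) (i : ZMod 6)
    (e : G.Dart) : R.IsLeftDartAt c i e ↔ B R c i ∧ e = R.σ (R.σ (c.darts i)) := by
  obtain ⟨h1, h2, h3, hall⟩ := rot3 hG R (c.darts i)
  constructor
  · rintro ⟨hf, hne, hnb, hno⟩
    have hB : B R c i := by
      by_contra hB
      have hr : ¬ R.IsRightDartAt c i e := fun h => hno h.2.2.2
      rw [right_iff hG] at hr
      have hA := (A_or_B hG R c i).resolve_right hB
      rcases hall e hf with h | h | h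
      · exact hne h
      · exact hr ⟨hB, h⟩
      · apply hnb
        rw [h]
        apply R.σ.injective
        rw [h3]
        exact hA.symm
    refine ⟨hB, ?_⟩
    rcases hall e hf with h | h | h
    · exact absurd h hne
    · exact absurd (h.trans hB) hnb
    · exact h
  · rintro ⟨hB, rfl⟩
    refine ⟨by simp [R.tail_fixed], h2, ?_, ?_⟩
    · intro h
      rw [← (show R.σ (c.darts i) = _ from hB)] at h
      exact h1 (R.σ.injective h)
    · rintro ⟨m, hm, -, hl⟩
      exact hl 1 one_pos hm (by rw [pow_one]; exact hB)

lemma exists_right_iff (hG : G.IsCubic) (R : RotationSystem G) (c : DirCycle G 6) (i : ZMod 6) :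
    (∃ e, R.IsRightDartAt c i e) ↔ ¬ B R c i := by
  simp [right_iff hG]

lemma exists_left_iff (hG : G.IsCubic) (R : RotationSystem G) (c : DirCycle G 6) (i : ZMod 6) :
    (∃ e, R.IsLeftDartAt c i e) ↔ B R c i := by
  simp [left_iff hG]

lemma card_aux (c : DirCycle G 6) (P : ZMod 6 → Prop) (Q : ZMod 6 → G.Dart → Prop)
    (t : ZMod 6 → G.Dart) (ht : ∀ i, (t i).fst = vtx c i)
    (hQ : ∀ i e, Q i e ↔ P i ∧ e = t i) :
    Nat.card {e : G.Dart // ∃ i : ZMod 6, Q i e} = Nat.card {i : ZMod 6 // P i} := by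
  symm
  have hinj : Function.Injective t := by
    intro i j h
    apply vinj c
    rw [← ht, ← ht, h]
  refine Nat.card_eq_of_bijective
    (fun i : {i : ZMod 6 // P i} => (⟨t i.1, i.1, (hQ _ _).2 ⟨i.2, rfl⟩⟩ :
      {e : G.Dart // ∃ i : ZMod 6, Q i e})) ⟨?_, ?_⟩
  · intro i j h
    exact Subtype.ext (hinj (congrArg Subtype.val h))
  · rintro ⟨e, i, hi⟩
    obtain ⟨hp, rfl⟩ := (hQ _ _).1 hi
    exact ⟨⟨i, hp⟩, rfl⟩

/-- The reversed cycle. -/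
def rev (c : DirCycle G 6) : DirCycle G 6 where
  darts i := (c.darts (-i - 1)).symm
  chain i := by
    have := back_fst c (-(i + 1))
    rw [this]
    change (c.darts (-i - 1)).fst = _
    unfold vtx
    congr 2
    ring
  inj := by
    intro i j h
    change ((c.darts (-i - 1)).symm).fst = ((c.darts (-j - 1)).symm).fst at h
    rw [back_fst, back_fst] at h
    exact neg_injective (vinj c h)

lemma rev_vtx (c : DirCycle G 6) (i : ZMod 6) : vtx (rev c) i = vtx c (-i) :=
  back_fst c (-i)

lemma rev_back (c : DirCycle G 6) (i : ZMod 6) :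
    ((rev c).darts (i - 1)).symm = c.darts (-i) := by
  change ((c.darts (-(i - 1) - 1)).symm).symm = _
  rw [SimpleGraph.Dart.symm_symm]
  congr 1
  ring

lemma rev_B (R : RotationSystem G) (c : DirCycle G 6) (i : ZMod 6) :
    B R (rev c) i ↔ A R c (-i) := by
  unfold B A
  rw [rev_back]
  rfl

lemma rev_A (R : RotationSystem G) (c : DirCycle G 6) (i : ZMod 6) :
    A R (rev c) i ↔ B R c (-i) := by
  unfold B A
  rw [rev_back]
  rfl

lemma rev_induced (c : DirCycle G 6) (h : c.Induced) : (rev c).Induced := by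
  have hv : ∀ u, u ∈ (rev c).vertices → u ∈ c.vertices := by
    rintro u ⟨i, rfl⟩
    exact ⟨-i, (rev_vtx c i).symm⟩
  intro u w huw hu hw
  obtain ⟨k, hk⟩ := h u w huw (hv u hu) (hv w hw)
  refine ⟨-k - 1, ?_⟩
  rw [← hk]
  change ((c.darts (-(-k - 1) - 1)).symm).edge = _
  rw [SimpleGraph.Dart.edge_symm]
  have : -(-k - 1) - 1 = k := by ring
  rw [this]

/-- Distinct faces sharing two vertices. -/
lemma two_common {R : RotationSystem G} (hR : R.Polyhedral) {d d' : G.Dart}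
    (hd : ¬ R.SameFace d d') {x y : V} (hxy : x ≠ y)
    (hx : x ∈ R.faceVerts d) (hx' : x ∈ R.faceVerts d')
    (hy : y ∈ R.faceVerts d) (hy' : y ∈ R.faceVerts d') :
    G.Adj x y ∧ s(x, y) ∈ R.faceEdges d ∧ s(x, y) ∈ R.faceEdges d' ∧
      ∀ z, z ∈ R.faceVerts d → z ∈ R.faceVerts d' → z = x ∨ z = y := by
  rcases hR.2 d d' hd with h | ⟨v, h, -⟩ | ⟨u, w, hadj, h, he⟩
  · have : x ∈ R.faceVerts d ∩ R.faceVerts d' := ⟨hx, hx'⟩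
    rw [h] at this
    exact this.elim
  · have h1 : x ∈ R.faceVerts d ∩ R.faceVerts d' := ⟨hx, hx'⟩
    have h2 : y ∈ R.faceVerts d ∩ R.faceVerts d' := ⟨hy, hy'⟩
    rw [h] at h1 h2
    exact absurd (h1.trans h2.symm) hxy
  · have h1 : x ∈ R.faceVerts d ∩ R.faceVerts d' := ⟨hx, hx'⟩
    have h2 : y ∈ R.faceVerts d ∩ R.faceVerts d' := ⟨hy, hy'⟩
    have h3 : ∀ z, z ∈ R.faceVerts d → z ∈ R.faceVerts d' → z = u ∨ z = w := by
      intro z hz hz'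
      have : z ∈ R.faceVerts d ∩ R.faceVerts d' := ⟨hz, hz'⟩
      rw [h] at this
      exact this
    have he' : s(u, w) ∈ R.faceEdges d ∩ R.faceEdges d' := by rw [he]; rfl
    rw [h] at h1 h2
    rcases h1 with rfl | h1
    · rcases h2 with h2 | h2
      · exact absurd h2.symm hxy
      · obtain rfl := h2
        exact ⟨hadj, he'.1, he'.2, h3⟩
    · obtain rfl := h1
      rcases h2 with rfl | h2
      · rw [Sym2.eq_swap]
        exact ⟨hadj.symm, he'.1, he'.2, fun z hz hz' => (h3 z hz hz').symm⟩
      · exact absurd h2.symm hxy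

lemma sf_step (R : RotationSystem G) (d : G.Dart) : R.SameFace d (R.faceMap d) :=
  Equiv.Perm.sameCycle_apply_right.2 (Equiv.Perm.SameCycle.refl _ _)

lemma face_g (R : RotationSystem G) (c : DirCycle G 6) (i : ZMod 6) :
    R.faceMap (c.darts i).symm = R.σ (c.darts i) := by
  change R.σ ((c.darts i).symm).symm = _
  rw [SimpleGraph.Dart.symm_symm]

lemma face_e (R : RotationSystem G) (c : DirCycle G 6) (i : ZMod 6) :
    R.faceMap (c.darts i) = R.σ (c.darts i).symm := rfl

lemma sf_B {R : RotationSystem G} {c : DirCycle G 6} {i : ZMod 6} (h : B R c i) :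
    R.SameFace (c.darts i).symm (c.darts (i - 1)).symm := by
  have := sf_step R (c.darts i).symm
  rw [face_g, (show R.σ (c.darts i) = _ from h)] at this
  exact this

lemma sf_A {R : RotationSystem G} {c : DirCycle G 6} {i : ZMod 6} (h : A R c i) :
    R.SameFace (c.darts (i - 1)) (c.darts i) := by
  have := sf_step R (c.darts (i - 1))
  rw [face_e, (show R.σ (c.darts (i - 1)).symm = _ from h)] at this
  exact this

/-- A vertex with `¬ B` separates the two faces there. -/
lemma sep {R : RotationSystem G} (hR : R.Polyhedral) {c : DirCycle G 6} {i : ZMod 6}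
    (h : ¬ B R c i) : ¬ R.SameFace (c.darts i).symm (c.darts (i - 1)).symm := by
  intro hs
  apply h
  have h1 := sf_step R (c.darts i).symm
  rw [face_g] at h1
  refine hR.1 _ _ (h1.symm.trans hs) ?_
  rw [R.tail_fixed, back_fst]
  rfl

lemma run {R : RotationSystem G} {c : DirCycle G 6} (j : ZMod 6) (n : ℕ)
    (h : ∀ k : ℕ, k < n → B R c (j - k)) :
    R.SameFace (c.darts j).symm (c.darts (j - n)).symm := by
  induction n with
  | zero => rw [Nat.cast_zero, sub_zero]; exact Equiv.Perm.SameCycle.refl _ _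
  | succ n ih =>
    have h1 := ih (fun k hk => h k (by omega))
    have h2 := sf_B (h n (by omega))
    have : j - ((n + 1 : ℕ) : ZMod 6) = j - n - 1 := by push_cast; ring
    rw [this]
    exact h1.trans h2

lemma arc {R : RotationSystem G} {c : DirCycle G 6} (i j : ZMod 6)
    (h : ∀ k, k ≠ i → k ≠ j → B R c k) :
    R.SameFace (c.darts i).symm (c.darts (j - 1)).symm := by
  have key : ∀ i j : ZMod 6, (j - 1 - (((j - 1 - i).val : ℕ) : ZMod 6) = i) ∧
      ∀ k < (j - 1 - i).val, (j - 1 - ((k : ℕ) : ZMod 6) ≠ i) ∧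
        (j - 1 - ((k : ℕ) : ZMod 6) ≠ j) := by decide
  obtain ⟨h1, h2⟩ := key i j
  have := run (R := R) (c := c) (j - 1) (j - 1 - i).val
    (fun k hk => h _ (h2 k hk).1 (h2 k hk).2)
  rw [h1] at this
  exact this.symm

lemma not_adjacent {R : RotationSystem G} (hR : R.Polyhedral) {c : DirCycle G 6}
    {i : ZMod 6} {d : G.Dart} (hs : ¬ R.SameFace (c.darts i).symm d)
    (hd : R.SameFace d (c.darts (i - 1)).symm)
    (he : (c.darts i).edge ∈ R.faceEdges d) : False := by
  obtain ⟨d', hd', hee⟩ := he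
  rcases (SimpleGraph.dart_edge_eq_iff _ _).1 hee with rfl | rfl
  · refine out_ne_back c i (hR.1 _ _ (hd'.symm.trans hd) ?_)
    rw [back_fst]; rfl
  · exact hs hd'.symm

/-- At most two exceptional positions is impossible (unless there are none). -/
lemma le_two {R : RotationSystem G} (hR : R.Polyhedral) {c : DirCycle G 6} (hind : c.Induced)
    (i j : ZMod 6) (hi : ¬ B R c i) (hj : ¬ B R c j)
    (h : ∀ k, k ≠ i → k ≠ j → B R c k) : False := by
  have h1 := arc (R := R) (c := c) i j h
  have h2 := arc (R := R) (c := c) j i (fun k a b => h k b a)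
  by_cases hij : i = j
  · subst hij
    exact sep hR hi h1
  have hs : ¬ R.SameFace (c.darts i).symm (c.darts j).symm := fun hs => sep hR hi (hs.trans h2)
  have self : ∀ k, vtx c k ∈ R.faceVerts (c.darts k).symm := fun k =>
    ⟨_, sf_step R _, by rw [face_g, R.tail_fixed]; rfl⟩
  obtain ⟨hadj, he1, he2, -⟩ := two_common hR hs (fun hv => hij (vinj c hv))
    (self i) ⟨_, h2, back_fst c i⟩ ⟨_, h1, back_fst c j⟩ (self j)
  obtain ⟨k, hk⟩ := hind _ _ hadj ⟨i, rfl⟩ ⟨j, rfl⟩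
  change (c.darts k).edge = s(vtx c i, vtx c j) at hk
  have hk' : (c.darts k).edge = s(vtx c k, vtx c (k + 1)) := by
    rw [← snd_eq]; rfl
  have hk2 := hk
  rw [hk', Sym2.eq_iff] at hk2
  rcases hk2 with ⟨a, -⟩ | ⟨a, -⟩
  · obtain rfl := vinj c a
    rw [← hk] at he2
    exact not_adjacent hR hs h2 he2
  · obtain rfl := vinj c a
    rw [← hk] at he1
    exact not_adjacent hR (fun x => hs x.symm) h1 he1

/-- Three consecutive positions is impossible. -/
lemma not_three {R : RotationSystem G} (hR : R.Polyhedral) {c : DirCycle G 6}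
    (i : ZMod 6) (a0 : A R c i) (a1 : A R c (i + 1)) (a2 : A R c (i + 2))
    (b3 : B R c (i + 3)) (b4 : B R c (i + 4)) (b5 : B R c (i + 5)) : False := by
  have e0 := sf_A a0
  have e1 := sf_A a1
  have e2 := sf_A a2
  have f5 := sf_B b5
  have f4 := sf_B b4
  have f3 := sf_B b3
  have q0 : i + 1 - 1 = i := by ring
  have q1 : i + 2 - 1 = i + 1 := by ring
  have q2 : i + 3 - 1 = i + 2 := by ring
  have q3 : i + 4 - 1 = i + 3 := by ring
  have q4 : i + 5 - 1 = i + 4 := by ring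
  have q5 : i - 1 = i + 5 :=
    (by decide : ∀ i : ZMod 6, i - 1 = i + 5) i
  have q6 : i + 5 + 1 = i := by rw [← q5]; ring
  rw [q5] at e0
  rw [q0] at e1
  rw [q1] at e2
  rw [q2] at f3
  rw [q3] at f4
  rw [q4] at f5
  have E2 := (e0.trans e1).trans e2
  have E3 := E2.trans (sf_step R _)
  have hs : ¬ R.SameFace (c.darts (i + 5)) (c.darts (i + 5)).symm := by
    intro hs
    have := hR.1 _ _ (e0.symm.trans hs) (by
      have := back_fst c i
      rw [q5] at this
      rw [this]; rfl)
    rw [← q5] at this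
    exact out_ne_back c i this
  have m3 : vtx c (i + 3) ∈ R.faceVerts (c.darts (i + 5)) := by
    refine ⟨_, E3, ?_⟩
    rw [face_e, R.tail_fixed]
    have := back_fst c (i + 3)
    rwa [q2] at this
  have m3' : vtx c (i + 3) ∈ R.faceVerts (c.darts (i + 5)).symm := by
    refine ⟨_, (f5.trans f4).trans f3, ?_⟩
    have := back_fst c (i + 3)
    rwa [q2] at this
  have m0' : vtx c i ∈ R.faceVerts (c.darts (i + 5)).symm := by
    refine ⟨_, Equiv.Perm.SameCycle.refl _ _, ?_⟩
    have := back_fst c i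
    rwa [q5] at this
  have m5' : vtx c (i + 5) ∈ R.faceVerts (c.darts (i + 5)).symm := by
    refine ⟨_, f5, ?_⟩
    have := back_fst c (i + 5)
    rwa [q4] at this
  have d1 : i ≠ i + 5 :=
    (by decide : ∀ i : ZMod 6, i ≠ i + 5) i
  have d2 : i + 3 ≠ i :=
    (by decide : ∀ i : ZMod 6, i + 3 ≠ i) i
  have d3 : i + 3 ≠ i + 5 :=
    (by decide : ∀ i : ZMod 6, i + 3 ≠ i + 5) i
  obtain ⟨-, -, -, hz⟩ := two_common hR hs (fun hv => d1 (vinj c hv))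
    ⟨_, e0, rfl⟩ m0' ⟨_, Equiv.Perm.SameCycle.refl _ _, rfl⟩ m5'
  rcases hz _ m3 m3' with h | h
  · exact d2 (vinj c h)
  · exact d3 (vinj c h)

/-- The combinatorial constraints on the left positions. -/
def Good (b : ZMod 6 → Bool) : Prop :=
    (¬ ∀ i, b i = true) ∧ (¬ ∀ i, b i = false) ∧
    (∀ i j, ¬ (b i = false ∧ b j = false ∧ ∀ k, k = i ∨ k = j ∨ b k = true)) ∧
    (∀ i j, ¬ (b i = true ∧ b j = true ∧ ∀ k, k = i ∨ k = j ∨ b k = false)) ∧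
    (∀ i, ¬ (b i = false ∧ b (i + 1) = false ∧ b (i + 2) = false ∧
      b (i + 3) = true ∧ b (i + 4) = true ∧ b (i + 5) = true))

/-- The desired conclusion about the left positions. -/
def Fine (b : ZMod 6 → Bool) : Prop :=
    (Finset.univ.filter (fun i => b i = true)).card = 3 ∧
    (Finset.univ.filter (fun i => b i = false)).card = 3 ∧
    (¬ ∃ i, b i = true ∧ b (i + 1) = true ∧ b (i + 2) = true) ∧
    (¬ ∃ i, b i = false ∧ b (i + 1) = false ∧ b (i + 2) = false)

instance (b : ZMod 6 → Bool) : Decidable (Good b) := by unfold Good; infer_instance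

instance (b : ZMod 6 → Bool) : Decidable (Fine b) := by unfold Fine; infer_instance

set_option maxRecDepth 100000 in
set_option maxHeartbeats 2000000 in
lemma bool_aux : ∀ b : ZMod 6 → Bool, Good b → Fine b := by
  decide

lemma prop_aux (P : ZMod 6 → Prop) [DecidablePred P]
    (h1 : ¬ ∀ i, P i) (h2 : ¬ ∀ i, ¬ P i)
    (h3 : ∀ i j, ¬ P i → ¬ P j → ¬ (∀ k, k ≠ i → k ≠ j → P k))
    (h4 : ∀ i j, P i → P j → ¬ (∀ k, k ≠ i → k ≠ j → ¬ P k))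
    (h5 : ∀ i, ¬ (¬ P i ∧ ¬ P (i + 1) ∧ ¬ P (i + 2) ∧ P (i + 3) ∧ P (i + 4) ∧ P (i + 5))) :
    Nat.card {i // P i} = 3 ∧ Nat.card {i // ¬ P i} = 3 ∧
    (¬ ∃ i, P i ∧ P (i + 1) ∧ P (i + 2)) ∧
    (¬ ∃ i, ¬ P i ∧ ¬ P (i + 1) ∧ ¬ P (i + 2)) := by
  have hf : Fine (fun i : ZMod 6 => decide (P i)) := by
    apply bool_aux
    unfold Good
    simp only [decide_eq_true_eq, decide_eq_false_iff_not]
    refine ⟨h1, h2, ?_, ?_, h5⟩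
    · rintro i j ⟨hi, hj, h⟩
      exact h3 i j hi hj (fun k hk hk' => ((h k).resolve_left hk).resolve_left hk')
    · rintro i j ⟨hi, hj, h⟩
      exact h4 i j hi hj (fun k hk hk' => ((h k).resolve_left hk).resolve_left hk')
  unfold Fine at hf
  simp only [decide_eq_true_eq, decide_eq_false_iff_not] at hf
  obtain ⟨m1, m2, m3, m4⟩ := hf
  refine ⟨?_, ?_, m3, m4⟩
  · rw [Nat.card_eq_fintype_card, Fintype.card_subtype]
    convert m1
  · rw [Nat.card_eq_fintype_card, Fintype.card_subtype]
    convert m2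

end HexAux

/-- In a polyhedral embedding of a cubic graph, an induced 6-cycle is either a facial
cycle or has exactly 3 darts leaving to each side, in which case on neither side do
the three tails of these darts form a path of length 2 on the cycle. -/
theorem induced_hexagon_facial_or_three_three
    {V : Type*} [Fintype V] [DecidableEq V] {G : SimpleGraph V}
    (hG : G.IsCubic) (R : RotationSystem G) (hR : R.Polyhedral)
    (c : DirCycle G 6) (hind : c.Induced) :
    R.IsFacialCycle c ∨
      (Nat.card {e : G.Dart // ∃ i : ZMod 6, R.IsLeftDartAt c i e} = 3 ∧
       Nat.card {e : G.Dart // ∃ i : ZMod 6, R.IsRightDartAt c i e} = 3 ∧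
       (¬ ∃ i : ZMod 6, (∃ e : G.Dart, R.IsLeftDartAt c i e) ∧
          (∃ e : G.Dart, R.IsLeftDartAt c (i + 1) e) ∧
          (∃ e : G.Dart, R.IsLeftDartAt c (i + 2) e)) ∧
       (¬ ∃ i : ZMod 6, (∃ e : G.Dart, R.IsRightDartAt c i e) ∧
          (∃ e : G.Dart, R.IsRightDartAt c (i + 1) e) ∧
          (∃ e : G.Dart, R.IsRightDartAt c (i + 2) e))) := by
  classical
  have hAB : ∀ i, HexAux.A R c i ↔ ¬ HexAux.B R c i := fun i =>
    ⟨fun ha hb => HexAux.not_A_and_B hG R c i ⟨ha, hb⟩,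
      fun hb => (HexAux.A_or_B hG R c i).resolve_right hb⟩
  by_cases hall : ∀ i, HexAux.B R c i
  · left; right
    intro i
    rw [HexAux.face_g, (show R.σ (c.darts (i + 1)) = _ from hall (i + 1)), add_sub_cancel_right]
  by_cases hnone : ∀ i, ¬ HexAux.B R c i
  · left; left
    intro i
    have := (hAB (i + 1)).2 (hnone (i + 1))
    unfold HexAux.A at this
    rw [add_sub_cancel_right] at this
    exact this
  right
  have hrevB : ∀ i, HexAux.B R (HexAux.rev c) i ↔ ¬ HexAux.B R c (-i) := fun i => by
    rw [HexAux.rev_B, hAB]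
  obtain ⟨m1, m2, m3, m4⟩ := HexAux.prop_aux (HexAux.B R c) hall hnone
    (fun i j hi hj h => HexAux.le_two hR hind i j hi hj h)
    (by
      intro i j hi hj h
      refine HexAux.le_two hR (HexAux.rev_induced c hind) (-i) (-j) ?_ ?_ ?_
      · rw [hrevB, neg_neg, not_not]; exact hi
      · rw [hrevB, neg_neg, not_not]; exact hj
      · intro k hk hk'
        rw [hrevB]
        exact h _ (fun e => hk (by rw [← e, neg_neg])) (fun e => hk' (by rw [← e, neg_neg])))
    (by
      rintro i ⟨h0, h1, h2, h3, h4, h5⟩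
      exact HexAux.not_three hR i ((hAB _).2 h0) ((hAB _).2 h1) ((hAB _).2 h2) h3 h4 h5)
  simp only [HexAux.exists_left_iff hG, HexAux.exists_right_iff hG]
  refine ⟨?_, ?_, m3, m4⟩
  · rw [HexAux.card_aux c (HexAux.B R c) _ (fun i => R.σ (R.σ (c.darts i)))
      (fun i => by simp [R.tail_fixed, HexAux.vtx]) (HexAux.left_iff hG R c)]
    exact m1
  · rw [HexAux.card_aux c (fun i => ¬ HexAux.B R c i) _ (fun i => R.σ (c.darts i))
      (fun i => by simp [R.tail_fixed, HexAux.vtx]) (HexAux.right_iff hG R c)]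
    exact m2
end

section
/- Define two vertices of a cubic graph G to be related if they lie on a common cycle of length 3, 4, or 5, and let ≈ be the reflexive-transitive closure of this relation. If v ≈ w, then any two polyhedral embeddings of G that have the same rotation at v (the same cyclic order of darts at v) also have the same rotation at w. In other words, within each equivalence class of ≈, the rotation at one vertex uniquely determines the rotation at every other vertex in any polyhedral embedding of G. -/
open SimpleGraph

/-- Two vertices are related if they lie on a common cycle of length 3, 4 or 5. -/
def RelatedSmallCycle {V : Type*} (G : SimpleGraph V) (v w : V) : Prop :=
  ∃ (u : V) (p : G.Walk u u), p.IsCycle ∧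
    (p.length = 3 ∨ p.length = 4 ∨ p.length = 5) ∧ v ∈ p.support ∧ w ∈ p.support


namespace RotationSystem

section helpers

variable {V : Type*} [Fintype V] [DecidableEq V] {G : SimpleGraph V}

/-- At `v`, the dart to `y` follows the dart to `x`; equivalently the facial walk that
arrives from `x` at `v` continues to `y`. -/
def Nx (R : RotationSystem G) (x v y : V) : Prop :=
  ∃ (h : G.Adj v x) (h' : G.Adj v y), R.σ ⟨(v, x), h⟩ = ⟨(v, y), h'⟩

/-- The face through the dart `x → z` contains the vertex `y`. -/
def Mm (R : RotationSystem G) (x z y : V) : Prop :=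
  ∃ h : G.Adj x z, y ∈ R.faceVerts ⟨(x, z), h⟩

theorem Nx.face {R : RotationSystem G} {x v y : V} (h : R.Nx x v y) :
    R.SameFace ⟨(x, v), h.1.symm⟩ ⟨(v, y), h.2.1⟩ := by
  obtain ⟨h1, h2, h3⟩ := h
  refine ⟨1, ?_⟩
  rw [zpow_one]
  exact h3

theorem faceVerts_congr {R : RotationSystem G} {d d' : G.Dart} (h : R.SameFace d d') (y : V) :
    y ∈ R.faceVerts d ↔ y ∈ R.faceVerts d' := by
  constructor
  · rintro ⟨e, he, h2⟩
    exact ⟨e, (Equiv.Perm.SameCycle.symm h).trans he, h2⟩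
  · rintro ⟨e, he, h2⟩
    exact ⟨e, Equiv.Perm.SameCycle.trans h he, h2⟩

theorem Nx.mm {R : RotationSystem G} {x v y : V} (h : R.Nx x v y) {z : V}
    (hm : R.Mm x v z) : R.Mm v y z :=
  ⟨h.2.1, (faceVerts_congr h.face z).1 hm.2⟩

theorem mm_fst {R : RotationSystem G} {x z : V} (h : G.Adj x z) : R.Mm x z x :=
  ⟨h, _, Equiv.Perm.SameCycle.refl _ _, rfl⟩

theorem Nx.fn {R : RotationSystem G} {x v y z : V} (h : R.Nx x v y) (h' : R.Nx x v z) :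
    y = z := by
  obtain ⟨_, _, h3⟩ := h
  obtain ⟨_, _, h3'⟩ := h'
  rw [h3] at h3'
  simpa using congrArg (fun d : G.Dart => d.snd) h3'

theorem Nx.inj {R : RotationSystem G} {x v y z : V} (h : R.Nx x v y) (h' : R.Nx z v y) :
    x = z := by
  obtain ⟨_, _, h3⟩ := h
  obtain ⟨_, _, h3'⟩ := h'
  have := R.σ.injective (h3.trans h3'.symm)
  simpa using congrArg (fun d : G.Dart => d.snd) this

/-- Every corner has a successor. -/
theorem exists_nx (R : RotationSystem G) {x v : V} (h : G.Adj v x) : ∃ y, R.Nx x v y := by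
  have h1 := R.tail_fixed ⟨(v, x), h⟩
  rcases hd : R.σ ⟨(v, x), h⟩ with ⟨⟨a, b⟩, hab⟩
  rw [hd] at h1
  simp only at h1
  subst h1
  exact ⟨b, h, hab, hd⟩

theorem pol_edge {R : RotationSystem G} (hR : R.Polyhedral) {d d' : G.Dart}
    (hn : ¬ R.SameFace d d') {x y : V} (hxy : x ≠ y)
    (hx : x ∈ R.faceVerts d) (hx' : x ∈ R.faceVerts d')
    (hy : y ∈ R.faceVerts d) (hy' : y ∈ R.faceVerts d') :
    G.Adj x y ∧ s(x, y) ∈ R.faceEdges d := by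
  have mx : x ∈ R.faceVerts d ∩ R.faceVerts d' := ⟨hx, hx'⟩
  have my : y ∈ R.faceVerts d ∩ R.faceVerts d' := ⟨hy, hy'⟩
  rcases hR.2 d d' hn with h | ⟨v, h, _⟩ | ⟨u, w, ha, h, he⟩
  · rw [h] at mx; exact mx.elim
  · rw [h] at mx my
    exact (hxy (mx.trans my.symm)).elim
  · rw [h] at mx my
    have key : s(u, w) ∈ R.faceEdges d ∩ R.faceEdges d' := by rw [he]; rfl
    simp only [Set.mem_insert_iff, Set.mem_singleton_iff] at mx my
    rcases mx with rfl | rfl <;> rcases my with rfl | rfl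
    · exact (hxy rfl).elim
    · exact ⟨ha, key.1⟩
    · exact ⟨ha.symm, by rw [Sym2.eq_swap]; exact key.1⟩
    · exact (hxy rfl).elim

/-- Facial cycles have no chords. -/
theorem Nx.chord {R : RotationSystem G} (hR : R.Polyhedral) {w x z y : V}
    (h : R.Nx w x z) (hxy : G.Adj x y) (hm : R.Mm x z y) : y = z ∨ y = w := by
  obtain ⟨hxz, hy⟩ := hm
  have hx : x ∈ R.faceVerts ⟨(x, z), hxz⟩ := ⟨_, Equiv.Perm.SameCycle.refl _ _, rfl⟩
  by_cases hs : R.SameFace ⟨(x, z), hxz⟩ ⟨(x, y), hxy⟩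
  · have := hR.1 _ _ hs rfl
    left
    simpa using (congrArg (fun d : G.Dart => d.snd) this).symm
  · have hx' : x ∈ R.faceVerts ⟨(x, y), hxy⟩ := ⟨_, Equiv.Perm.SameCycle.refl _ _, rfl⟩
    have hy' : y ∈ R.faceVerts ⟨(x, y), hxy⟩ := by
      obtain ⟨q, hq⟩ := R.exists_nx hxy.symm
      exact ⟨_, hq.face, rfl⟩
    obtain ⟨_, ⟨⟨⟨a, b⟩, hab⟩, hsd, hd⟩⟩ := pol_edge hR hs hxy.ne hx hx' hy hy'
    simp only [Sym2.eq_iff, Dart.edge] at hd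
    rcases hd with ⟨ha, hb⟩ | ⟨ha, hb⟩
    · subst ha; subst hb
      exact (hs hsd).elim
    · subst ha; subst hb
      right
      obtain ⟨q, hq⟩ := R.exists_nx hxy
      have h1 := hR.1 _ _ (Equiv.Perm.SameCycle.trans hsd hq.face) rfl
      have h2 : z = q := by simpa using congrArg (fun d : G.Dart => d.snd) h1
      subst h2
      exact hq.inj h

/-- Two faces at `x` meeting again in `y` force `x` and `y` to be adjacent. -/
theorem meet {R : RotationSystem G} (hR : R.Polyhedral) {x z w y : V}
    (hzw : z ≠ w) (hxy : x ≠ y) (h1 : R.Mm x z y) (h2 : R.Mm x w y) : G.Adj x y := by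
  obtain ⟨hz, hy⟩ := h1
  obtain ⟨hw, hy'⟩ := h2
  have hs : ¬ R.SameFace ⟨(x, z), hz⟩ ⟨(x, w), hw⟩ := by
    intro hs
    have := hR.1 _ _ hs rfl
    exact hzw (by simpa using congrArg (fun d : G.Dart => d.snd) this)
  exact (pol_edge hR hs hxy ⟨_, Equiv.Perm.SameCycle.refl _ _, rfl⟩
    ⟨_, Equiv.Perm.SameCycle.refl _ _, rfl⟩ hy hy').1

theorem orbit_sub (R : RotationSystem G) {v x : V} (hx : G.Adj v x) (P : V → Prop)
    (hP : P x) (hc : ∀ a b, P a → R.Nx a v b → P b) {t : V} (ht : G.Adj v t) : P t := by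
  have : Finite G.Dart :=
    Finite.of_injective (fun d : G.Dart => d.toProd) SimpleGraph.Dart.toProd_injective
  obtain ⟨n, _, hn⟩ := (R.orbit_tail ⟨(v, x), hx⟩ ⟨(v, t), ht⟩ rfl).exists_pow_eq'
  have key : ∀ n : ℕ, ∃ (b : V) (hb : G.Adj v b), (R.σ ^ n) ⟨(v, x), hx⟩ = ⟨(v, b), hb⟩ ∧ P b := by
    intro n
    induction n with
    | zero => exact ⟨x, hx, rfl, hP⟩
    | succ n ih =>
      obtain ⟨b, hb, h1, h2⟩ := ih
      obtain ⟨c, hc'⟩ := R.exists_nx hb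
      refine ⟨c, hc'.2.1, ?_, hc b c h2 hc'⟩
      rw [pow_succ', Equiv.Perm.mul_apply, h1]
      exact hc'.2.2
  obtain ⟨b, hb, h1, h2⟩ := key n
  rw [h1] at hn
  have : b = t := by simpa using congrArg (fun d : G.Dart => d.snd) hn
  exact this ▸ h2

theorem third (hG : G.IsCubic) {v x y : V} (hx : G.Adj v x) (hy : G.Adj v y) (hxy : x ≠ y) :
    ∃ t, G.Adj v t ∧ t ≠ x ∧ t ≠ y ∧ ∀ a, G.Adj v a → a = x ∨ a = y ∨ a = t := by
  have h3 := hG v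
  rw [Nat.card_coe_set_eq, Set.ncard_eq_three] at h3
  obtain ⟨p, q, r, h1, h2, h4, h5⟩ := h3
  have hm : ∀ a, G.Adj v a ↔ a = p ∨ a = q ∨ a = r := by
    intro a
    rw [← SimpleGraph.mem_neighborSet, h5]
    simp
  simp only [hm] at hx hy ⊢
  rcases hx with rfl | rfl | rfl <;> rcases hy with rfl | rfl | rfl <;>
    first
    | exact (hxy rfl).elim
    | exact ⟨p, by grind⟩
    | exact ⟨q, by grind⟩
    | exact ⟨r, by grind⟩

theorem corner (R : RotationSystem G) (hG : G.IsCubic) {v x y : V} (hx : G.Adj v x)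
    (hy : G.Adj v y) (hxy : x ≠ y) :
    ∃ t, G.Adj v t ∧ t ≠ x ∧ t ≠ y ∧ (∀ a, G.Adj v a → a = x ∨ a = y ∨ a = t) ∧
      ((R.Nx x v y ∧ R.Nx y v t ∧ R.Nx t v x ∧ ¬ R.Nx y v x) ∨
       (R.Nx y v x ∧ R.Nx x v t ∧ R.Nx t v y ∧ ¬ R.Nx x v y)) := by
  obtain ⟨t, ht, htx, hty, hall⟩ := third hG hx hy hxy
  refine ⟨t, ht, htx, hty, hall, ?_⟩
  obtain ⟨x', hx'⟩ := R.exists_nx hx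
  obtain ⟨y', hy'⟩ := R.exists_nx hy
  obtain ⟨t', ht'⟩ := R.exists_nx ht
  have fx : x' ≠ x := by
    rintro rfl
    exact hxy (R.orbit_sub hx (fun a => a = x') rfl
      (fun a b ha hb => by subst ha; exact hb.fn hx') hy).symm
  have fy : y' ≠ y := by
    rintro rfl
    exact hxy (R.orbit_sub hy (fun a => a = y') rfl
      (fun a b ha hb => by subst ha; exact hb.fn hy') hx)
  have ft : t' ≠ t := by
    rintro rfl
    exact htx (R.orbit_sub ht (fun a => a = t') rfl
      (fun a b ha hb => by subst ha; exact hb.fn ht') hx).symm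
  have ix : x' ≠ y' := fun h => hxy (hx'.inj (h ▸ hy'))
  have iy : y' ≠ t' := fun h => hty.symm (hy'.inj (h ▸ ht'))
  have it : x' ≠ t' := fun h => htx.symm (hx'.inj (h ▸ ht'))
  have nn : ∀ {b}, R.Nx x v b → b = x' := fun h => h.fn hx'
  have nm : ∀ {b}, R.Nx y v b → b = y' := fun h => h.fn hy'
  have ax := hall _ hx'.2.1
  have ay := hall _ hy'.2.1
  have azt := hall _ ht'.2.1
  grind

end helpers

section cycles

variable {V : Type*} [Fintype V] [DecidableEq V] {G : SimpleGraph V}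

/-- The two rotation systems agree at `v`. -/
def Agree (R₁ R₂ : RotationSystem G) (v : V) : Prop :=
  ∀ d : G.Dart, d.fst = v → R₁.σ d = R₂.σ d

theorem agree_iff (R₁ R₂ : RotationSystem G) (hG : G.IsCubic) {v x y : V} (hx : G.Adj v x)
    (hy : G.Adj v y) (hxy : x ≠ y) : Agree R₁ R₂ v ↔ (R₁.Nx x v y ↔ R₂.Nx x v y) := by
  have h0 : Agree R₁ R₂ v ↔ ∀ a b, R₁.Nx a v b → R₂.Nx a v b := by
    constructor
    · rintro h a b ⟨h1, h2, h3⟩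
      exact ⟨h1, h2, by rw [← h _ rfl, h3]⟩
    · rintro h ⟨⟨v', a⟩, ha⟩ rfl
      obtain ⟨b, hb⟩ := R₁.exists_nx ha
      exact hb.2.2.trans (h _ _ hb).2.2.symm
  rw [h0]
  obtain ⟨t, ht, htx, hty, hall, h1⟩ := R₁.corner hG hx hy hxy
  obtain ⟨t₂, ht₂, htx₂, hty₂, hall₂, h2⟩ := R₂.corner hG hx hy hxy
  have htt : t₂ = t := by have := hall _ ht₂; grind
  subst htt
  constructor
  · intro h
    refine ⟨h _ _, fun h' => ?_⟩
    rcases h1 with h1 | h1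
    · exact h1.1
    · have := h _ _ h1.1
      grind
  · intro h a b hab
    have e := hall _ hab.1
    have hf : ∀ c, R₁.Nx a v c → b = c := fun c hc => hab.fn hc
    grind

theorem tri {R : RotationSystem G} (hG : G.IsCubic) (hR : R.Polyhedral) {a b c : V}
    (hab : G.Adj a b) (hbc : G.Adj b c) (hca : G.Adj c a)
    (h : R.Nx c a b) : R.Nx a b c := by
  obtain ⟨t, ht, h1, h2, h3, h4 | h4⟩ := R.corner hG hab.symm hbc hca.ne'
  · exact h4.1
  · have := h4.2.1.chord hR hbc (h4.2.1.mm (h.mm (mm_fst hca)))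
    grind

theorem tri_iff {R : RotationSystem G} (hG : G.IsCubic) (hR : R.Polyhedral) {a b c : V}
    (hab : G.Adj a b) (hbc : G.Adj b c) (hca : G.Adj c a) :
    R.Nx c a b ↔ R.Nx a b c :=
  ⟨tri hG hR hab hbc hca, fun h => tri hG hR hca hab hbc (tri hG hR hbc hca hab h)⟩

/-- Two consecutive equal turns on a 4-cycle force the third. -/
theorem quad_step {R : RotationSystem G} (hG : G.IsCubic) (hR : R.Polyhedral) {a b c d : V}
    (hbc : G.Adj b c) (hcd : G.Adj c d) (hda : G.Adj d a) (hbd : b ≠ d)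
    (h1 : R.Nx d a b) (h2 : R.Nx a b c) : R.Nx b c d := by
  obtain ⟨t, ht, e1, e2, e3, h4 | h4⟩ := R.corner hG hbc.symm hcd hbd
  · exact h4.1
  · have := h4.2.1.chord hR hcd (h4.2.1.mm (h2.mm (h1.mm (mm_fst hda))))
    grind

theorem quad_alt {R : RotationSystem G} (hG : G.IsCubic) (hR : R.Polyhedral) {a b c d : V}
    (hab : G.Adj a b) (hbc : G.Adj b c) (hcd : G.Adj c d) (hda : G.Adj d a)
    (hac : a ≠ c) (hbd : b ≠ d)
    (h1 : R.Nx d a b) (h2 : R.Nx c b a) (h3 : R.Nx b c d) : G.Adj b d := by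
  obtain ⟨t, ht, e1, e2, e3, h4 | h4⟩ := R.corner hG hab.symm hbc hac
  · exact (h4.2.2.2 h2).elim
  · refine meet hR (z := t) (w := c) e2 hbd (h4.2.1.mm (h1.mm (mm_fst hda))) ?_
    obtain ⟨q, hq⟩ := R.exists_nx hcd.symm
    exact ⟨hbc, ⟨(d, q), hq.2.1⟩, (h3.face.trans hq.face), rfl⟩

theorem quad_nochord {R : RotationSystem G} (hR : R.Polyhedral) {a b c d : V}
    (hcd : G.Adj c d) (hda : G.Adj d a)
    (h1 : R.Nx d a b) (h2 : R.Nx a b c) : ¬ G.Adj b d := by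
  intro h
  have := h2.chord hR h (h2.mm (h1.mm (mm_fst hda)))
  rcases this with rfl | rfl
  · exact hcd.ne rfl
  · exact hda.ne rfl

theorem dich (R : RotationSystem G) (hG : G.IsCubic) {v x y : V} (hx : G.Adj v x)
    (hy : G.Adj v y) (hxy : x ≠ y) :
    (R.Nx x v y ∧ ¬ R.Nx y v x) ∨ (R.Nx y v x ∧ ¬ R.Nx x v y) := by
  obtain ⟨t, ht, e1, e2, e3, h4 | h4⟩ := R.corner hG hx hy hxy
  · exact Or.inl ⟨h4.1, h4.2.2.2⟩
  · exact Or.inr ⟨h4.1, h4.2.2.2⟩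

theorem quad_iff {R : RotationSystem G} (hG : G.IsCubic) (hR : R.Polyhedral) {a b c d : V}
    (hab : G.Adj a b) (hbc : G.Adj b c) (hcd : G.Adj c d) (hda : G.Adj d a)
    (hac : a ≠ c) (hbd : b ≠ d) :
    (R.Nx d a b ↔ R.Nx a b c) ↔ ¬ G.Adj b d := by
  have s1 := quad_step hG hR hbc hcd hda hbd
  have s2 := quad_step hG hR hcd hda hab hac.symm
  have s3 := quad_step hG hR hda hab hbc hbd.symm
  have s4 := quad_step hG hR hab hbc hcd hac
  have r1 := quad_step hG hR hab.symm hda.symm hcd.symm hbd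
  have r2 := quad_step hG hR hbc.symm hab.symm hda.symm hac.symm
  have r3 := quad_step hG hR hcd.symm hbc.symm hab.symm hbd.symm
  have r4 := quad_step hG hR hda.symm hcd.symm hbc.symm hac
  have n1 := quad_nochord hR (b := b) hcd hda
  have n2 := quad_nochord hR (b := d) hbc.symm hab.symm
  have t1 := quad_alt hG hR hab hbc hcd hda hac hbd
  have t2 := quad_alt hG hR hbc.symm hab.symm hda.symm hcd.symm hac.symm hbd
  have hc : G.Adj b d ↔ G.Adj d b := G.adj_comm b d
  rcases R.dich hG hda.symm hab hbd.symm with ⟨a1, a2⟩ | ⟨a1, a2⟩ <;>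
  rcases R.dich hG hab.symm hbc hac with ⟨b1, b2⟩ | ⟨b1, b2⟩ <;>
  rcases R.dich hG hbc.symm hcd hbd with ⟨c1, c2⟩ | ⟨c1, c2⟩ <;>
  rcases R.dich hG hcd.symm hda hac.symm with ⟨d1, d2⟩ | ⟨d1, d2⟩ <;>
  grind

/-- Three consecutive equal turns on a 5-cycle force the fourth. -/
theorem penta_step {R : RotationSystem G} (hG : G.IsCubic) (hR : R.Polyhedral) {a b c d e : V}
    (hcd : G.Adj c d) (hde : G.Adj d e) (hea : G.Adj e a) (hce : c ≠ e)
    (h1 : R.Nx e a b) (h2 : R.Nx a b c) (h3 : R.Nx b c d) : R.Nx c d e := by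
  obtain ⟨t, ht, e1, e2, e3, h4 | h4⟩ := R.corner hG hcd.symm hde hce
  · exact h4.1
  · have := h4.2.1.chord hR hde (h4.2.1.mm (h3.mm (h2.mm (h1.mm (mm_fst hea)))))
    grind

theorem penta_nochord {R : RotationSystem G} (hR : R.Polyhedral) {a b c d e : V}
    (hde : G.Adj d e) (hea : G.Adj e a) (had : a ≠ d) (hbe : b ≠ e)
    (hab : G.Adj a b)
    (h1 : R.Nx e a b) (h2 : R.Nx a b c) (h3 : R.Nx b c d) : ¬ G.Adj a c ∧ ¬ G.Adj c e := by
  constructor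
  · intro h
    rcases h3.chord hR h.symm (h3.mm (h2.mm (mm_fst hab))) with h' | h'
    · exact had h'
    · exact hab.ne h'
  · intro h
    rcases h3.chord hR h (h3.mm (h2.mm (h1.mm (mm_fst hea)))) with h' | h'
    · exact hde.ne h'.symm
    · exact hbe h'.symm

theorem penta_pat {R : RotationSystem G} (hG : G.IsCubic) (hR : R.Polyhedral) {a b c d e : V}
    (hab : G.Adj a b) (hbc : G.Adj b c) (hcd : G.Adj c d) (hde : G.Adj d e) (hea : G.Adj e a)
    (hac : a ≠ c) (had : a ≠ d) (hbd : b ≠ d) (hbe : b ≠ e) (hce : c ≠ e)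
    (h1 : R.Nx e a b) (h2 : R.Nx a b c) (h3 : R.Nx d c b) (h4 : R.Nx c d e) (h5 : R.Nx a e d) :
    G.Adj c e ∧ ¬ G.Adj a c ∧ ¬ G.Adj a d ∧ ¬ G.Adj b d ∧ ¬ G.Adj b e := by
  have hce' : G.Adj c e := by
    obtain ⟨t, ht, e1, e2, e3, h | h⟩ := R.corner hG hbc.symm hcd hbd
    · exact (h.2.2.2 h3).elim
    · refine meet hR (z := t) (w := d) e2 hce (h.2.1.mm (h2.mm (h1.mm (mm_fst hea)))) ?_
      obtain ⟨q, hq⟩ := R.exists_nx hde.symm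
      exact ⟨hcd, ⟨(e, q), hq.2.1⟩, (h4.face.trans hq.face), rfl⟩
  obtain ⟨s, hs, a1, a2, a3, ha | ha⟩ := R.corner hG hea.symm hab hbe.symm
  swap
  · exact (ha.2.2.2 h1).elim
  obtain ⟨t, ht, b1, b2, b3, hb | hb⟩ := R.corner hG hab.symm hbc hac
  swap
  · exact (hb.2.2.2 h2).elim
  obtain ⟨u, hu, d1, d2, d3, hd | hd⟩ := R.corner hG hcd.symm hde hce
  swap
  · exact (hd.2.2.2 h4).elim
  obtain ⟨x, hx, c1, c2, c3, -⟩ := R.corner hG hbc.symm hcd hbd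
  obtain ⟨y, hy, e1, e2, e3, -⟩ := R.corner hG hde.symm hea had.symm
  have ne1 := hab.ne
  have ne2 := hbc.ne
  have ne3 := hcd.ne
  have ne4 := hde.ne
  have ne5 := hea.ne
  refine ⟨hce', ?_, ?_, ?_, ?_⟩
  · intro h
    have := c3 _ h.symm
    have := c3 _ hce'
    grind
  · intro h
    have q1 := a3 _ h
    have q2 := d3 _ h.symm
    have hsd : s = d := by grind
    have hua : u = a := by grind
    subst hsd
    subst hua
    have := hb.2.1.chord hR hab.symm
      (hb.2.1.mm (h3.mm (hd.2.2.1.mm (mm_fst h))))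
    grind
  · intro h
    have q1 := b3 _ h
    have q2 := d3 _ h.symm
    have htd : t = d := by grind
    have hub : u = b := by grind
    subst htd
    subst hub
    have := ha.2.1.chord hR hea.symm
      (ha.2.1.mm (hb.2.2.1.mm (hd.2.1.mm (mm_fst hde.symm))))
    grind
  · intro h
    have := e3 _ h.symm
    have := e3 _ hce'.symm
    grind

theorem penta_iff {R : RotationSystem G} (hG : G.IsCubic) (hR : R.Polyhedral) {a b c d e : V}
    (hab : G.Adj a b) (hbc : G.Adj b c) (hcd : G.Adj c d) (hde : G.Adj d e) (hea : G.Adj e a)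
    (hac : a ≠ c) (had : a ≠ d) (hbd : b ≠ d) (hbe : b ≠ e) (hce : c ≠ e) :
    (R.Nx e a b ↔ R.Nx a b c) ↔
      ¬ G.Adj a c ∧ ¬ G.Adj a d ∧ ¬ G.Adj b d ∧ ¬ G.Adj b e := by
  have s1 := penta_step hG hR (a := a) (b := b) hcd hde hea hce
  have s2 := penta_step hG hR (a := b) (b := c) hde hea hab had.symm
  have s3 := penta_step hG hR (a := c) (b := d) hea hab hbc hbe.symm
  have s4 := penta_step hG hR (a := d) (b := e) hab hbc hcd hac
  have s5 := penta_step hG hR (a := e) (b := a) hbc hcd hde hbd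
  have r1 := penta_step hG hR (a := e) (b := d) hbc.symm hab.symm hea.symm hac.symm
  have r2 := penta_step hG hR (a := d) (b := c) hab.symm hea.symm hde.symm hbe
  have r3 := penta_step hG hR (a := c) (b := b) hea.symm hde.symm hcd.symm had
  have r4 := penta_step hG hR (a := b) (b := a) hde.symm hcd.symm hbc.symm hce.symm
  have r5 := penta_step hG hR (a := a) (b := e) hcd.symm hbc.symm hab.symm hbd.symm
  have m1 := penta_nochord hR (c := c) hde hea had hbe hab
  have m2 := penta_nochord hR (c := d) hea hab hbe hac.symm hbc
  have m3 := penta_nochord hR (c := b) hcd hde hce.symm had hea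
  have w1 := penta_nochord hR (c := c) hab.symm hea.symm hbe.symm had.symm hde.symm
  have w2 := penta_nochord hR (c := d) hbc.symm hab.symm hac hbe.symm hea.symm
  have w3 := penta_nochord hR (c := b) hea.symm hde.symm had.symm hce hcd.symm
  have p1 := penta_pat hG hR hab hbc hcd hde hea hac had hbd hbe hce
  have p2 := penta_pat hG hR hbc hcd hde hea hab hbd hbe hce hac.symm had.symm
  have p3 := penta_pat hG hR hcd hde hea hab hbc hce hac.symm had.symm hbd.symm hbe.symm
  have p4 := penta_pat hG hR hde hea hab hbc hcd had.symm hbd.symm hbe.symm hce.symm hac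
  have p5 := penta_pat hG hR hea hab hbc hcd hde hbe.symm hce.symm hac had hbd
  have q1 := penta_pat hG hR hab.symm hea.symm hde.symm hcd.symm hbc.symm
    hbe hbd had hac hce.symm
  have q2 := penta_pat hG hR hbc.symm hab.symm hea.symm hde.symm hcd.symm
    hac.symm hce hbe hbd had
  have q3 := penta_pat hG hR hcd.symm hbc.symm hab.symm hea.symm hde.symm
    hbd.symm had.symm hac.symm hce hbe
  have q4 := penta_pat hG hR hde.symm hcd.symm hbc.symm hab.symm hea.symm
    hce.symm hbe.symm hbd.symm had.symm hac.symm
  have q5 := penta_pat hG hR hea.symm hde.symm hcd.symm hbc.symm hab.symm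
    had hac hce.symm hbe.symm hbd.symm
  simp only [G.adj_comm c a, G.adj_comm d a, G.adj_comm d b, G.adj_comm e b, G.adj_comm e c] at *
  rcases R.dich hG hea.symm hab hbe.symm with ⟨a1, a2⟩ | ⟨a1, a2⟩ <;>
  rcases R.dich hG hab.symm hbc hac with ⟨b1, b2⟩ | ⟨b1, b2⟩ <;>
  rcases R.dich hG hbc.symm hcd hbd with ⟨c1, c2⟩ | ⟨c1, c2⟩ <;>
  rcases R.dich hG hcd.symm hde hce with ⟨d1, d2⟩ | ⟨d1, d2⟩ <;>
  rcases R.dich hG hde.symm hea had.symm with ⟨e1, e2⟩ | ⟨e1, e2⟩ <;>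
  grind

/-- Agreement spreads over a small cycle. -/
theorem agree_related (hG : G.IsCubic) {R₁ R₂ : RotationSystem G} (h₁ : R₁.Polyhedral)
    (h₂ : R₂.Polyhedral) {v w : V} (h : RelatedSmallCycle G v w) (hv : Agree R₁ R₂ v) :
    Agree R₁ R₂ w := by
  have T : ∀ a b c : V, G.Adj a b → G.Adj b c → G.Adj c a →
      Agree R₁ R₂ a → Agree R₁ R₂ b := by
    intro a b c hab hbc hca h
    rw [agree_iff R₁ R₂ hG hca.symm hab hbc.ne'] at h
    rw [agree_iff R₁ R₂ hG hab.symm hbc hca.ne']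
    rw [← tri_iff hG h₁ hab hbc hca, ← tri_iff hG h₂ hab hbc hca]
    exact h
  have Q : ∀ a b c d : V, G.Adj a b → G.Adj b c → G.Adj c d → G.Adj d a → a ≠ c → b ≠ d →
      Agree R₁ R₂ a → Agree R₁ R₂ b := by
    intro a b c d hab hbc hcd hda hac hbd h
    rw [agree_iff R₁ R₂ hG hda.symm hab hbd.symm] at h
    rw [agree_iff R₁ R₂ hG hab.symm hbc hac]
    have e1 := quad_iff hG h₁ hab hbc hcd hda hac hbd
    have e2 := quad_iff hG h₂ hab hbc hcd hda hac hbd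
    tauto
  have P : ∀ a b c d e : V, G.Adj a b → G.Adj b c → G.Adj c d → G.Adj d e → G.Adj e a →
      a ≠ c → a ≠ d → b ≠ d → b ≠ e → c ≠ e → Agree R₁ R₂ a → Agree R₁ R₂ b := by
    intro a b c d e hab hbc hcd hde hea hac had hbd hbe hce h
    rw [agree_iff R₁ R₂ hG hea.symm hab hbe.symm] at h
    rw [agree_iff R₁ R₂ hG hab.symm hbc hac]
    have e1 := penta_iff hG h₁ hab hbc hcd hde hea hac had hbd hbe hce
    have e2 := penta_iff hG h₂ hab hbc hcd hde hea hac had hbd hbe hce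
    have e3 := e1.trans e2.symm
    clear e1 e2
    tauto
  obtain ⟨u, p, hp, hl, hvp, hwp⟩ := h
  have hq := hp.rotate hvp
  have hql : (p.rotate v hvp).length = p.length := by simp
  have hw : w ∈ (p.rotate v hvp).support := by
    simpa using hwp
  rw [← hql] at hl
  generalize p.rotate v hvp = q at hq hl hw
  clear hql hp hvp hwp p
  have hnd := hq.support_nodup
  rcases hl with hl | hl | hl
  · rcases q with _ | ⟨i1, _ | ⟨i2, _ | ⟨i3, _ | ⟨i4, q⟩⟩⟩⟩ <;> simp at hl
    rename_i b c
    simp at hnd hw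
    have hb := T _ _ _ i1 i2 i3 hv
    have hc := T _ _ _ i2 i3 i1 hb
    rcases hw with rfl | rfl | rfl | rfl <;> assumption
  · rcases q with _ | ⟨i1, _ | ⟨i2, _ | ⟨i3, _ | ⟨i4, _ | ⟨i5, q⟩⟩⟩⟩⟩ <;> simp at hl
    rename_i b c d
    simp at hnd hw
    have n1 : v ≠ c := by grind
    have n2 : b ≠ d := by grind
    have hb := Q _ _ _ _ i1 i2 i3 i4 n1 n2 hv
    have hc := Q _ _ _ _ i2 i3 i4 i1 n2 n1.symm hb
    have hd := Q _ _ _ _ i3 i4 i1 i2 n1.symm n2.symm hc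
    rcases hw with rfl | rfl | rfl | rfl | rfl <;> assumption
  · rcases q with _ | ⟨i1, _ | ⟨i2, _ | ⟨i3, _ | ⟨i4, _ | ⟨i5, _ | ⟨i6, q⟩⟩⟩⟩⟩⟩ <;> simp at hl
    rename_i b c d e
    simp at hnd hw
    have n1 : v ≠ c := by grind
    have n2 : v ≠ d := by grind
    have n3 : b ≠ d := by grind
    have n4 : b ≠ e := by grind
    have n5 : c ≠ e := by grind
    have hb := P _ _ _ _ _ i1 i2 i3 i4 i5 n1 n2 n3 n4 n5 hv
    have hc := P _ _ _ _ _ i2 i3 i4 i5 i1 n3 n4 n5 n1.symm n2.symm hb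
    have hd := P _ _ _ _ _ i3 i4 i5 i1 i2 n5 n1.symm n2.symm n3.symm n4.symm hc
    have he := P _ _ _ _ _ i4 i5 i1 i2 i3 n2.symm n3.symm n4.symm n5.symm n1 hd
    rcases hw with rfl | rfl | rfl | rfl | rfl | rfl <;> assumption

end cycles

end RotationSystem

/-- If two vertices of a cubic graph are related by the reflexive-transitive closure
of lying on a common cycle of length 3, 4 or 5, then in any polyhedral embedding the
rotation at one determines the rotation at the other. -/
theorem rotation_determined_on_equivalence_class
    {V : Type*} [Fintype V] [DecidableEq V] {G : SimpleGraph V}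
    (hG : G.IsCubic) {v w : V}
    (hvw : Relation.ReflTransGen (RelatedSmallCycle G) v w)
    (R₁ R₂ : RotationSystem G) (h₁ : R₁.Polyhedral) (h₂ : R₂.Polyhedral)
    (hrot : ∀ d : G.Dart, d.fst = v → R₁.σ d = R₂.σ d) :
    ∀ d : G.Dart, d.fst = w → R₁.σ d = R₂.σ d := by
  
  have key : RotationSystem.Agree R₁ R₂ w := by
    induction hvw with
    | refl => exact hrot
    | tail _ hbc ih => exact RotationSystem.agree_related hG h₁ h₂ hbc ih
  exact key
end

section
/- An embedding σ of a cubic graph G is polyhedral if and only if (i) no facial walk of σ visits any vertex twice, and (ii) no two distinct faces of σ have more than two vertices in common. -/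
open SimpleGraph

namespace RotationSystem

variable {V : Type*} [Fintype V] [DecidableEq V] {G : SimpleGraph V}

/-- In a cubic graph two distinct darts with the same tail are consecutive in the rotation. -/
theorem consecutive_of_cubic (hG : G.IsCubic) (R : RotationSystem G) {d d' : G.Dart}
    (h : d.fst = d'.fst) (hne : d ≠ d') : R.σ d = d' ∨ R.σ d' = d := by
  classical
  have hcard : (R.σ.cycleOf d).support.card ≤ 3 := by
    have hsub : (R.σ.cycleOf d).support ⊆
        (Finset.univ : Finset G.Dart).filter (fun x => x.fst = d.fst) := by
      intro x hx
      have hs : R.σ.SameCycle d x := (Equiv.Perm.mem_support_cycleOf_iff.1 hx).1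
      obtain ⟨i, -, hi⟩ := hs.exists_pow_eq'
      have key : ∀ n : ℕ, ((R.σ ^ n) d).fst = d.fst := by
        intro n
        induction n with
        | zero => rfl
        | succ k ih => rw [pow_succ', Equiv.Perm.mul_apply, R.tail_fixed, ih]
      simp only [Finset.mem_filter, Finset.mem_univ, true_and]
      rw [← hi, key]
    refine (Finset.card_le_card hsub).trans ?_
    rw [G.dart_fst_fiber_card_eq_degree d.fst, ← SimpleGraph.card_neighborSet_eq_degree,
      ← Nat.card_eq_fintype_card, hG]
  have hs := R.orbit_tail d d' h
  have hsupp : d ∈ R.σ.support := by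
    rw [Equiv.Perm.mem_support]
    intro hfix
    obtain ⟨k, hk⟩ := hs
    rw [Equiv.Perm.zpow_apply_eq_self_of_apply_eq_self hfix] at hk
    exact hne hk
  obtain ⟨i, hi, hid⟩ := hs.exists_pow_eq_of_mem_support hsupp
  have hcyc : (R.σ ^ (R.σ.cycleOf d).support.card) d = d := by
    rw [← Equiv.Perm.pow_mod_card_support_cycleOf_self_apply, Nat.mod_self]
    rfl
  have h3 : i = 0 ∨ i = 1 ∨ i = 2 := by omega
  rcases h3 with rfl | rfl | rfl
  · exact absurd hid hne
  · left; simpa using hid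
  · right
    have hc : (R.σ.cycleOf d).support.card = 3 := by omega
    rw [hc, pow_succ', Equiv.Perm.mul_apply, hid] at hcyc
    exact hcyc

theorem sameFace_next (R : RotationSystem G) (d : G.Dart) :
    R.SameFace d (R.σ d.symm) :=
  ⟨1, by simp [faceMap, dartSymmPerm]⟩

/-- Both ends of an edge of a face are vertices of that face. -/
theorem ends_mem (R : RotationSystem G) {d : G.Dart} {u w : V}
    (h : s(u, w) ∈ R.faceEdges d) : u ∈ R.faceVerts d ∧ w ∈ R.faceVerts d := by
  obtain ⟨x, hx, he⟩ := h
  have h1 : x.fst ∈ R.faceVerts d := ⟨x, hx, rfl⟩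
  have h2 : x.snd ∈ R.faceVerts d :=
    ⟨R.σ x.symm, hx.trans (R.sameFace_next x), R.tail_fixed _⟩
  have he' : s(x.fst, x.snd) = s(u, w) := he
  rcases Sym2.eq_iff.1 he' with ⟨rfl, rfl⟩ | ⟨rfl, rfl⟩
  · exact ⟨h1, h2⟩
  · exact ⟨h2, h1⟩

/-- If `R.σ x = y` then the edge of `x` also lies on the face of `y`. -/
theorem edge_mem_of_rot (R : RotationSystem G) {d x y : G.Dart}
    (hy : R.SameFace d y) (hxy : R.σ x = y) : x.edge ∈ R.faceEdges d := by
  refine ⟨x.symm, ?_, x.edge_symm⟩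
  have := R.sameFace_next x.symm
  rw [SimpleGraph.Dart.symm_symm, hxy] at this
  exact hy.trans this.symm

/-- In a cubic graph two distinct faces that meet share an edge. -/
theorem exists_common_edge (hG : G.IsCubic) (R : RotationSystem G) {d d' : G.Dart}
    (hn : ¬ R.SameFace d d') {v : V} (hv : v ∈ R.faceVerts d ∩ R.faceVerts d') :
    ∃ x : G.Dart, x.edge ∈ R.faceEdges d ∩ R.faceEdges d' := by
  obtain ⟨⟨x, hx, hxv⟩, ⟨y, hy, hyv⟩⟩ := hv
  have hne : x ≠ y := by
    rintro rfl
    exact hn (hx.trans hy.symm)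
  rcases R.consecutive_of_cubic hG (hxv.trans hyv.symm) hne with h | h
  · exact ⟨x, ⟨x, hx, rfl⟩, R.edge_mem_of_rot hy h⟩
  · exact ⟨y, R.edge_mem_of_rot hx h, ⟨y, hy, rfl⟩⟩

end RotationSystem

/-- An embedding of a cubic graph is polyhedral iff no facial walk visits a vertex
twice and no two distinct faces share more than two vertices. -/
theorem polyhedral_iff_simple_faces_and_small_intersections
    {V : Type*} [Fintype V] [DecidableEq V] {G : SimpleGraph V}
    (hG : G.IsCubic) (R : RotationSystem G) :
    R.Polyhedral ↔
      R.FacesSimple ∧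
      ∀ d d' : G.Dart, ¬ R.SameFace d d' →
        (R.faceVerts d ∩ R.faceVerts d').ncard ≤ 2 := by
  constructor
  · rintro ⟨hs, h⟩
    refine ⟨hs, fun d d' hn => ?_⟩
    rcases h d d' hn with h | ⟨v, h, -⟩ | ⟨u, w, -, h, -⟩
    · simp [h]
    · simp [h]
    · rw [h]; exact (Set.ncard_insert_le u {w}).trans (by simp)
  · rintro ⟨hs, h⟩
    refine ⟨hs, fun d d' hn => ?_⟩
    rcases (R.faceVerts d ∩ R.faceVerts d').eq_empty_or_nonempty with h0 | ⟨v, hv⟩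
    · exact Or.inl h0
    right; right
    obtain ⟨x, hx⟩ := R.exists_common_edge hG hn hv
    have hx' : s(x.fst, x.snd) ∈ R.faceEdges d ∩ R.faceEdges d' := hx
    have e1 := R.ends_mem hx'.1
    have e2 := R.ends_mem hx'.2
    have hV : R.faceVerts d ∩ R.faceVerts d' = {x.fst, x.snd} := by
      symm
      apply Set.eq_of_subset_of_ncard_le
      · rintro z (rfl | rfl)
        · exact ⟨e1.1, e2.1⟩
        · exact ⟨e1.2, e2.2⟩
      · rw [Set.ncard_pair x.adj.ne]
        exact h d d' hn
      · exact Set.toFinite _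
    refine ⟨x.fst, x.snd, x.adj, hV, ?_⟩
    apply Set.Subset.antisymm
    · intro e he
      obtain ⟨y, -, hye⟩ := he.1
      have hye' : s(y.fst, y.snd) = e := hye
      subst hye'
      have f1 := R.ends_mem he.1
      have f2 := R.ends_mem he.2
      have g1 : y.fst ∈ R.faceVerts d ∩ R.faceVerts d' := ⟨f1.1, f2.1⟩
      have g2 : y.snd ∈ R.faceVerts d ∩ R.faceVerts d' := ⟨f1.2, f2.2⟩
      rw [hV] at g1 g2
      have hyne := y.adj.ne
      simp only [Set.mem_insert_iff, Set.mem_singleton_iff] at g1 g2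
      rw [Set.mem_singleton_iff, Sym2.eq_iff]
      rcases g1 with a | a <;> rcases g2 with b | b
      · exact absurd (a.trans b.symm) hyne
      · exact Or.inl ⟨a, b⟩
      · exact Or.inr ⟨a, b⟩
      · exact absurd (a.trans b.symm) hyne
    · rintro e rfl
      exact hx'
end
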